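/- arXiv:1108.3212 — 2 statements merged into one kernel-verified Lean document; each statement's English description precedes it below -/
import Mathlib

section
/- There exists N such that for all n ≥ N, there is no n-universal set of cardinality n+1 in the ring ℤ[i] of Gaussian integers. That is, for every set C ⊆ ℤ[i] with |C| = n+1 there exists a polynomial f with coefficients in the fraction field ℚ(i) of ℤ[i], of degree at most n, such that f(c) ∈ ℤ[i] for all c ∈ C but f(z) ∉ ℤ[i] for some z ∈ ℤ[i]. -/
open Polynomial

/-- The fraction field of the Gaussian integers. -/
abbrev FF : Type := FractionRing GaussianInt

/-- The canonical embedding of `ℤ[i]` into its fraction field. -/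
noncomputable def ι : GaussianInt →+* FF := algebraMap GaussianInt FF

/-- A polynomial with coefficients in the fraction field of `ℤ[i]` is integer-valued
if it takes values in (the image of) `ℤ[i]` at every Gaussian integer. -/
def IntegerValued (f : FF[X]) : Prop :=
  ∀ z : GaussianInt, f.eval (ι z) ∈ Set.range ι

/-- A set `M ⊆ ℤ[i]` is `n`-universal if every polynomial of degree at most `n`
with coefficients in the fraction field of `ℤ[i]` taking integer values on `M`
is integer-valued. -/
def IsNUniversal (n : ℕ) (M : Set GaussianInt) : Prop :=
  ∀ f : FF[X], f.natDegree ≤ n → (∀ c ∈ M, f.eval (ι c) ∈ Set.range ι) → IntegerValued f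

section
open Filter Topology MeasureTheory Set

noncomputable def fejK (x : ℝ) : ℝ := if x = 0 then 1 else 2 * (1 - Real.cos x) / x ^ 2

lemma fejK_nonneg (x : ℝ) : 0 ≤ fejK x := by
  unfold fejK
  split_ifs
  · norm_num
  · have := Real.cos_le_one x
    apply div_nonneg <;> nlinarith [sq_nonneg x]

lemma fejK_le (x : ℝ) : fejK x ≤ 5 * (1 + x ^ 2)⁻¹ := by
  unfold fejK
  split_ifs with h
  · subst h; norm_num
  · have hx : 0 < x ^ 2 := by positivity
    have h1 := Real.neg_one_le_cos x
    have h2 := Real.one_sub_sq_div_two_le_cos (x := x)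
    rw [← div_eq_mul_inv, div_le_div_iff₀ hx (by positivity)]
    nlinarith

lemma fejK_meas : Measurable fejK := by
  unfold fejK
  refine Measurable.ite (measurableSet_singleton 0) measurable_const ?_
  fun_prop

lemma fejK_integrable : Integrable fejK := by
  refine (integrable_inv_one_add_sq.const_mul 5).mono' fejK_meas.aestronglyMeasurable ?_
  filter_upwards with x
  rw [Real.norm_of_nonneg (fejK_nonneg x)]
  exact fejK_le x

lemma fejK_pos_int : 0 < ∫ x, fejK x := by
  have h1 : ∀ x ∈ Set.Icc (0:ℝ) 1, (1/2:ℝ) ≤ fejK x := by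
    intro x hx
    unfold fejK
    split_ifs with h
    · norm_num
    · have hx0 : 0 < x := lt_of_le_of_ne hx.1 (Ne.symm h)
      have := Real.cos_le_one_sub_mul_cos_sq (x := x)
      have h3 := Real.cos_bound (x := x) (by rw [abs_of_pos hx0]; exact hx.2)
      rw [abs_le] at h3
      rw [abs_of_pos hx0] at h3
      rw [le_div_iff₀ (by positivity)]
      have : x ^ 4 ≤ x ^ 2 := pow_le_pow_of_le_one hx0.le hx.2 (by norm_num)
      nlinarith [h3.2]
  calc (0:ℝ) < ∫ x in Set.Icc (0:ℝ) 1, (1/2:ℝ) := by simp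
    _ ≤ ∫ x in Set.Icc (0:ℝ) 1, fejK x := by
        apply setIntegral_mono_on _ fejK_integrable.integrableOn measurableSet_Icc h1
        simp
    _ ≤ ∫ x, fejK x := setIntegral_le_integral fejK_integrable (Eventually.of_forall fejK_nonneg)

lemma fejK_eq {T : ℝ} (hT : 0 < T) (x : ℝ) :
    ∫ t in (0:ℝ)..T, (1 - t / T) * (2 * Real.cos (t * x)) = T * fejK (T * x) := by
  by_cases hx : x = 0
  · subst hx
    simp only [mul_zero, Real.cos_zero, fejK, if_true]
    have : ∀ t ∈ Set.uIcc 0 T, HasDerivAt (fun t => 2 * t - t ^ 2 / T) ((1 - t / T) * (2 * 1)) t := by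
      intro t _
      have := ((hasDerivAt_id t).const_mul 2).sub (((hasDerivAt_id t).pow 2).div_const T)
      convert! this using 1
      simp; ring
    rw [intervalIntegral.integral_eq_sub_of_hasDerivAt this]
    · field_simp; ring
    · apply Continuous.intervalIntegrable; fun_prop
  · have : ∀ t ∈ Set.uIcc 0 T, HasDerivAt (fun t => 2 * ((1 - t / T) * (Real.sin (t * x) / x) - Real.cos (t * x) / (T * x ^ 2))) ((1 - t / T) * (2 * Real.cos (t * x))) t := by
      intro t _
      have h1 : HasDerivAt (fun t : ℝ => t * x) x t := by simpa using (hasDerivAt_id t).mul_const x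
      have h2 : HasDerivAt (fun t : ℝ => 1 - t / T) (-(1 / T)) t := by
        simpa using ((hasDerivAt_id t).div_const T).const_sub 1
      have := ((h2.mul (h1.sin.div_const x)).sub (h1.cos.div_const (T * x ^ 2))).const_mul 2
      convert! this using 1
      field_simp; ring
    rw [intervalIntegral.integral_eq_sub_of_hasDerivAt this]
    · have : T * x ≠ 0 := mul_ne_zero hT.ne' hx
      simp only [fejK, this, if_false]
      simp
      field_simp
      ring
    · apply Continuous.intervalIntegrable; fun_prop

/-- Fubini step -/
lemma wi_fubini {e : ℝ → ℝ} (he : Measurable e) {M : ℝ} (hM : ∀ u, |e u| ≤ M) {G : ℂ → ℂ}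
    (hG : ∀ s : ℂ, 0 < s.re → ∫ u in Ioi (0:ℝ), (e u : ℂ) * Complex.exp (-s * u) = G s)
    {T : ℝ} (hT : 0 < T) (v : ℝ) {σ : ℝ} (hσ : 0 < σ) :
    ∫ u in Ioi (0:ℝ), ((e u * Real.exp (-σ * u) * (T * fejK (T * (v - u))) : ℝ) : ℂ) =
    ∫ t in (0:ℝ)..T, ((1 - t / T : ℝ) : ℂ) * (Complex.exp (Complex.I * t * v) * G (σ + Complex.I * t)
      + Complex.exp (-(Complex.I * t * v)) * G (σ - Complex.I * t)) := by
  have h0 : ∀ u : ℝ, ((e u * Real.exp (-σ * u) * (T * fejK (T * (v - u))) : ℝ) : ℂ) =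
      ∫ t in Ioc (0:ℝ) T, ((e u * Real.exp (-σ * u) * ((1 - t / T) * (2 * Real.cos (t * (v - u)))) : ℝ) : ℂ) := by
    intro u
    rw [integral_complex_ofReal, integral_const_mul, ← intervalIntegral.integral_of_le hT.le, fejK_eq hT]
  simp_rw [h0]
  have hM0 : 0 ≤ M := (abs_nonneg _).trans (hM 0)
  rw [integral_integral_swap, intervalIntegral.integral_of_le hT.le]
  · apply setIntegral_congr_fun measurableSet_Ioc
    intro t ht
    simp only
    rw [← hG (σ + Complex.I * t) (by simp [hσ]), ← hG (σ - Complex.I * t) (by simp [hσ])]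
    have hintg : ∀ s : ℂ, s.re = σ → Integrable (fun u : ℝ => (e u : ℂ) * Complex.exp (-s * u)) (volume.restrict (Ioi 0)) := by
      intro s hs
      refine ((integrableOn_exp_mul_Ioi (neg_lt_zero.2 hσ) 0).const_mul M).mono' ?_ ?_
      · apply Measurable.aestronglyMeasurable; fun_prop
      · filter_upwards with u
        rw [norm_mul, Complex.norm_exp, Complex.norm_real, Real.norm_eq_abs]
        have : (-s * (u:ℂ)).re = -σ * u := by simp [hs]
        rw [this]
        gcongr
        exact hM u
    rw [← integral_const_mul, ← integral_const_mul, ← integral_add, ← integral_const_mul]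
    · congr 1
      ext u
      push_cast
      rw [Complex.cos]
      have e1 : Complex.exp (Complex.I * t * v) * ((e u : ℂ) * Complex.exp (-(σ + Complex.I * t) * u)) =
        e u * (Complex.exp (-σ * u) * Complex.exp (t * (v - u) * Complex.I)) := by
        rw [mul_left_comm, ← Complex.exp_add, ← Complex.exp_add]; ring_nf
      have e2 : Complex.exp (-(Complex.I * t * v)) * ((e u : ℂ) * Complex.exp (-(σ - Complex.I * t) * u)) =
        e u * (Complex.exp (-σ * u) * Complex.exp (-(t * (v - u)) * Complex.I)) := by
        rw [mul_left_comm, ← Complex.exp_add, ← Complex.exp_add]; ring_nf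
      rw [e1, e2]
      ring
    · apply Integrable.const_mul; apply hintg; simp
    · apply Integrable.const_mul; apply hintg; simp
  · have hb : Integrable (fun p : ℝ × ℝ => (M * Real.exp (-σ * p.1)) * (2:ℝ)) ((volume.restrict (Ioi 0)).prod (volume.restrict (Ioc 0 T))) := by
      exact Integrable.mul_prod (f := fun u : ℝ => M * Real.exp (-σ * u)) (g := fun _ => (2:ℝ)) ((integrableOn_exp_mul_Ioi (neg_lt_zero.2 hσ) 0).const_mul M) (by simp)
    refine hb.mono' ?_ ?_
    · apply Measurable.aestronglyMeasurable
      unfold Function.uncurry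
      fun_prop
    · rw [Measure.prod_restrict]
      filter_upwards [ae_restrict_mem (measurableSet_Ioi.prod measurableSet_Ioc)] with p hp
      simp only [Function.uncurry]
      rw [Complex.norm_real, norm_mul, norm_mul, norm_mul, Real.norm_eq_abs, Real.norm_eq_abs, Real.norm_eq_abs, Real.norm_eq_abs, Real.abs_exp]
      have h1 : |1 - p.2 / T| ≤ 1 := by
        have h3 : 0 < p.2 / T := div_pos hp.2.1 hT
        have h4 : p.2 / T ≤ 1 := (div_le_one hT).2 hp.2.2
        rw [abs_le]; constructor <;> linarith
      have h2 : |2 * Real.cos (p.2 * (v - p.1))| ≤ 2 := by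
        rw [abs_mul]; have := Real.abs_cos_le_one (p.2 * (v - p.1)); simp; linarith
      have h3 : |1 - p.2 / T| * |2 * Real.cos (p.2 * (v - p.1))| ≤ 1 * 2 := by gcongr
      have := hM p.1
      calc |e p.1| * Real.exp (-σ * p.1) * (|1 - p.2 / T| * |2 * Real.cos (p.2 * (v - p.1))|) 
          ≤ (M * Real.exp (-σ * p.1)) * (1 * 2) := by gcongr
        _ = _ := by ring
end

section
open Filter Topology MeasureTheory Set

lemma fejK_scaled_integrable {T : ℝ} (hT : 0 < T) (v : ℝ) : Integrable (fun u => T * fejK (T * (v - u))) := by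
  have h1 : Integrable (fun u => fejK (T * u)) := fejK_integrable.comp_mul_left' hT.ne'
  exact (h1.comp_sub_left v).const_mul T

lemma wi_limit {e : ℝ → ℝ} (he : Measurable e) {M : ℝ} (hM : ∀ u, |e u| ≤ M) {G : ℂ → ℂ}
    (hG : ∀ s : ℂ, 0 < s.re → ∫ u in Ioi (0:ℝ), (e u : ℂ) * Complex.exp (-s * u) = G s)
    (hGc : ContinuousOn G {s | 0 ≤ s.re})
    {T : ℝ} (hT : 0 < T) (v : ℝ) :
    ∫ u in Ioi (0:ℝ), ((e u * (T * fejK (T * (v - u))) : ℝ) : ℂ) =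
    ∫ t in (0:ℝ)..T, ((1 - t / T : ℝ) : ℂ) * (Complex.exp (Complex.I * t * v) * G (Complex.I * t)
      + Complex.exp (-(Complex.I * t * v)) * G (- (Complex.I * t))) := by
  have hM0 : 0 ≤ M := (abs_nonneg _).trans (hM 0)
  have hL : Tendsto (fun σ : ℝ => ∫ u in Ioi (0:ℝ), ((e u * Real.exp (-σ * u) * (T * fejK (T * (v - u))) : ℝ) : ℂ)) (𝓝[>] 0) (𝓝 (∫ u in Ioi (0:ℝ), ((e u * (T * fejK (T * (v - u))) : ℝ) : ℂ))) := by
    apply tendsto_integral_filter_of_dominated_convergence (fun u => M * (T * fejK (T * (v - u))))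
    · filter_upwards with σ
      apply Measurable.aestronglyMeasurable
      have := fejK_meas
      fun_prop
    · filter_upwards [self_mem_nhdsWithin] with σ hσ
      filter_upwards [ae_restrict_mem measurableSet_Ioi] with u hu
      have hk : 0 ≤ T * fejK (T * (v - u)) := mul_nonneg hT.le (fejK_nonneg _)
      rw [Complex.norm_real, norm_mul, norm_mul, Real.norm_of_nonneg hk, Real.norm_eq_abs, Real.norm_eq_abs, Real.abs_exp]
      have h1 : Real.exp (-σ * u) ≤ 1 := by
        rw [Real.exp_le_one_iff]
        have := mul_pos (mem_Ioi.1 hσ) (mem_Ioi.1 hu)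
        linarith
      have : |e u| * Real.exp (-σ * u) ≤ M * 1 := mul_le_mul (hM u) h1 (Real.exp_pos _).le hM0
      rw [mul_one] at this
      exact mul_le_mul_of_nonneg_right this hk
    · exact ((fejK_scaled_integrable hT v).const_mul M).integrableOn
    · filter_upwards with u
      have : Continuous (fun σ : ℝ => ((e u * Real.exp (-σ * u) * (T * fejK (T * (v - u))) : ℝ) : ℂ)) := by fun_prop
      have := (this.tendsto 0).mono_left (nhdsWithin_le_nhds (s := Ioi 0))
      simpa using this
  have hcpt : IsCompact ((Icc (0:ℝ) 1) ×ℂ (Icc (-T) T)) := isCompact_Icc.reProdIm isCompact_Icc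
  obtain ⟨B, hB⟩ := hcpt.exists_bound_of_continuousOn (f := G) (hGc.mono (fun s hs => hs.1.1))
  have hR : Tendsto (fun σ : ℝ => ∫ t in (0:ℝ)..T, ((1 - t / T : ℝ) : ℂ) * (Complex.exp (Complex.I * t * v) * G (σ + Complex.I * t)
      + Complex.exp (-(Complex.I * t * v)) * G (σ - Complex.I * t))) (𝓝[>] 0) (𝓝 (∫ t in (0:ℝ)..T, ((1 - t / T : ℝ) : ℂ) * (Complex.exp (Complex.I * t * v) * G (Complex.I * t)
      + Complex.exp (-(Complex.I * t * v)) * G (- (Complex.I * t))))) := by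
    have hG1 : ∀ σ : ℝ, 0 < σ → Continuous (fun t : ℝ => G (σ + Complex.I * t)) := by
      intro σ hσ
      apply hGc.comp_continuous (by fun_prop)
      intro t; simp [hσ.le]
    have hG2 : ∀ σ : ℝ, 0 < σ → Continuous (fun t : ℝ => G (σ - Complex.I * t)) := by
      intro σ hσ
      apply hGc.comp_continuous (by fun_prop)
      intro t; simp [hσ.le]
    have hσc : Tendsto (fun σ : ℝ => (σ : ℂ)) (𝓝[>] 0) (𝓝 0) := by
      have : Continuous (fun σ : ℝ => (σ : ℂ)) := by fun_prop
      simpa using (this.tendsto 0).mono_left (nhdsWithin_le_nhds (s := Ioi 0))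
    apply intervalIntegral.tendsto_integral_filter_of_dominated_convergence (fun _ => 1 * (1 * B + 1 * B))
    · filter_upwards [self_mem_nhdsWithin] with σ hσ
      have g1 := hG1 σ hσ
      have g2 := hG2 σ hσ
      apply Continuous.aestronglyMeasurable
      exact Continuous.mul (by fun_prop) ((Continuous.mul (by fun_prop) g1).add (Continuous.mul (by fun_prop) g2))
    · have hlt : ∀ᶠ σ : ℝ in 𝓝[>] 0, σ < 1 := (eventually_lt_nhds (by norm_num : (0:ℝ) < 1)).filter_mono nhdsWithin_le_nhds
      filter_upwards [self_mem_nhdsWithin, hlt] with σ hσ hσ1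
      have hσ0 : 0 < σ := hσ
      filter_upwards with t ht
      rw [uIoc_of_le hT.le] at ht
      have h1 : |1 - t / T| ≤ 1 := by
        have h3 : 0 < t / T := div_pos ht.1 hT
        have h4 : t / T ≤ 1 := (div_le_one hT).2 ht.2
        rw [abs_le]; constructor <;> linarith
      have n1 : ‖Complex.exp (Complex.I * t * v)‖ = 1 := by rw [Complex.norm_exp]; simp
      have n2 : ‖Complex.exp (-(Complex.I * t * v))‖ = 1 := by rw [Complex.norm_exp]; simp
      have b1 := hB (σ + Complex.I * t) (by
        rw [Complex.mem_reProdIm]; simp; refine ⟨⟨hσ0.le, hσ1.le⟩, by linarith [ht.1], ht.2⟩)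
      have b2 := hB (σ - Complex.I * t) (by
        rw [Complex.mem_reProdIm]; simp; refine ⟨⟨hσ0.le, hσ1.le⟩, ht.2, by linarith [ht.1]⟩)
      have hB0 : 0 ≤ B := (norm_nonneg _).trans b1
      rw [norm_mul, Complex.norm_real, Real.norm_eq_abs]
      apply mul_le_mul h1 _ (norm_nonneg _) zero_le_one
      refine (norm_add_le _ _).trans ?_
      rw [norm_mul, norm_mul, n1, n2]
      linarith
    · simp
    · filter_upwards with t ht
      have l1 : Tendsto (fun σ : ℝ => G (σ + Complex.I * t)) (𝓝[>] 0) (𝓝 (G (Complex.I * t))) := by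
        have hw := hGc (Complex.I * t) (by simp)
        apply hw.tendsto.comp
        apply tendsto_nhdsWithin_iff.2
        constructor
        · simpa using hσc.add_const (Complex.I * t)
        · filter_upwards [self_mem_nhdsWithin] with σ hσ
          have hσ0 : 0 < σ := hσ
          simp [hσ0.le]
      have l2 : Tendsto (fun σ : ℝ => G (σ - Complex.I * t)) (𝓝[>] 0) (𝓝 (G (-(Complex.I * t)))) := by
        have hw := hGc (-(Complex.I * t)) (by simp)
        apply hw.tendsto.comp
        apply tendsto_nhdsWithin_iff.2
        constructor
        · simpa using hσc.sub_const (Complex.I * t)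
        · filter_upwards [self_mem_nhdsWithin] with σ hσ
          have hσ0 : 0 < σ := hσ
          simp [hσ0.le]
      exact ((l1.const_mul _).add (l2.const_mul _)).const_mul _
  refine tendsto_nhds_unique (hL.congr' ?_) hR
  filter_upwards [self_mem_nhdsWithin] with σ hσ
  exact wi_fubini he hM hG hT v hσ

lemma wi_rl (g : ℝ → ℂ) (c : ℝ) (hc : c ≠ 0) : Tendsto (fun v : ℝ => ∫ t : ℝ, Complex.exp (c * (Complex.I * t * v)) * g t) atTop (𝓝 0) := by
  have h := Real.tendsto_integral_exp_smul_cocompact g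
  have h2 : Tendsto (fun v : ℝ => -(c / (2 * Real.pi)) * v) atTop (cocompact ℝ) := by
    have hk : -(c / (2 * Real.pi)) ≠ 0 := neg_ne_zero.2 (div_ne_zero hc (by positivity))
    have : Tendsto (fun v : ℝ => -(c / (2 * Real.pi)) * v) (cocompact ℝ) (cocompact ℝ) :=
      (Homeomorph.mulLeft₀ _ hk).isClosedEmbedding.tendsto_cocompact
    exact this.mono_left atTop_le_cocompact
  refine (h.comp h2).congr ?_
  intro v
  simp only [Function.comp]
  congr 1
  ext t
  rw [Circle.smul_def, Real.fourierChar_apply, smul_eq_mul]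
  congr 2
  have : (Real.pi : ℂ) ≠ 0 := by exact_mod_cast Real.pi_ne_zero
  push_cast
  field_simp

lemma wi_tendsto {e : ℝ → ℝ} (he : Measurable e) {M : ℝ} (hM : ∀ u, |e u| ≤ M) {G : ℂ → ℂ}
    (hG : ∀ s : ℂ, 0 < s.re → ∫ u in Ioi (0:ℝ), (e u : ℂ) * Complex.exp (-s * u) = G s)
    (hGc : ContinuousOn G {s | 0 ≤ s.re})
    {T : ℝ} (hT : 0 < T) :
    Tendsto (fun v : ℝ => ∫ u in Ioi (0:ℝ), (e u * (T * fejK (T * (v - u))) : ℝ)) atTop (𝓝 0) := by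
  have hG1 : Continuous (fun t : ℝ => G (Complex.I * t)) := by
    apply hGc.comp_continuous (by fun_prop)
    intro t; simp
  have hG2 : Continuous (fun t : ℝ => G (-(Complex.I * t))) := by
    apply hGc.comp_continuous (by fun_prop)
    intro t; simp
  have r1 := wi_rl ((Ioc 0 T).indicator (fun t => ((1 - t / T : ℝ) : ℂ) * G (Complex.I * t))) 1 (by norm_num)
  have r2 := wi_rl ((Ioc 0 T).indicator (fun t => ((1 - t / T : ℝ) : ℂ) * G (-(Complex.I * t)))) (-1) (by norm_num)
  have r := r1.add r2
  have key : ∀ v : ℝ, ((∫ u in Ioi (0:ℝ), (e u * (T * fejK (T * (v - u))) : ℝ) : ℝ) : ℂ) = _ := fun v =>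
    (integral_complex_ofReal (μ := volume.restrict (Ioi 0)) (f := fun u => (e u * (T * fejK (T * (v - u))) : ℝ))).symm.trans (wi_limit he hM hG hGc hT v)
  have : Tendsto (fun v : ℝ => ((∫ u in Ioi (0:ℝ), (e u * (T * fejK (T * (v - u))) : ℝ) : ℝ) : ℂ)) atTop (𝓝 (0 + 0)) := by
    refine r.congr ?_
    intro v
    rw [key v, intervalIntegral.integral_of_le hT.le]
    have hind : ∀ a b : ℝ → ℂ, ∫ t, a t * (Ioc 0 T).indicator b t = ∫ t in Ioc 0 T, a t * b t := by
      intro a b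
      rw [← integral_indicator measurableSet_Ioc]
      congr 1
      ext t
      rw [indicator_mul_right]
    rw [hind, hind, ← integral_add]
    · congr 1
      ext t
      push_cast
      rw [one_mul, neg_one_mul]
      ring
    · apply Continuous.integrableOn_Ioc
      exact Continuous.mul (by fun_prop) (Continuous.mul (by fun_prop) hG1)
    · apply Continuous.integrableOn_Ioc
      exact Continuous.mul (by fun_prop) (Continuous.mul (by fun_prop) hG2)
  have h2 := (Complex.continuous_re.tendsto _).comp this
  simpa [Function.comp_def] using h2
end

section
open Filter Topology MeasureTheory Set

lemma fejK_scaled_total {T : ℝ} (hT : 0 < T) (v : ℝ) : ∫ u, T * fejK (T * (v - u)) = ∫ x, fejK x := by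
  rw [integral_sub_left_eq_self (fun u => T * fejK (T * u)) volume v, integral_const_mul, Measure.integral_comp_mul_left, abs_of_pos (inv_pos.2 hT), smul_eq_mul, mul_inv_cancel_left₀ hT.ne']

lemma fejK_scaled_interval {T : ℝ} (hT : 0 < T) (v δ : ℝ) (hδ : 0 ≤ δ) :
    ∫ u in Ioc (v - δ) (v + δ), T * fejK (T * (v - u)) = ∫ x in (-(T * δ))..(T * δ), fejK x := by
  rw [← intervalIntegral.integral_of_le (by linarith), intervalIntegral.integral_const_mul]
  have : ∀ u, T * (v - u) = T * v - T * u := fun u => by ring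
  simp_rw [this]
  rw [intervalIntegral.integral_comp_sub_mul _ hT.ne', smul_eq_mul, mul_inv_cancel_left₀ hT.ne']
  congr 1 <;> ring

lemma fejK_cA_tendsto : Tendsto (fun A : ℝ => ∫ x in (-A)..A, fejK x) atTop (𝓝 (∫ x, fejK x)) :=
  intervalIntegral_tendsto_integral fejK_integrable tendsto_neg_atTop_atBot tendsto_id

lemma fejK_cA_le (A : ℝ) (hA : 0 ≤ A) : ∫ x in (-A)..A, fejK x ≤ ∫ x, fejK x := by
  rw [intervalIntegral.integral_of_le (by linarith)]
  exact setIntegral_le_integral fejK_integrable (Eventually.of_forall fejK_nonneg)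

lemma fejK_half_tendsto {T : ℝ} (hT : 0 < T) : Tendsto (fun v => ∫ u in Ioi (0:ℝ), T * fejK (T * (v - u))) atTop (𝓝 (∫ x, fejK x)) := by
  have h1 : Tendsto (fun v => ∫ x in (-(T * v))..(T * v), fejK x) atTop (𝓝 (∫ x, fejK x)) :=
    fejK_cA_tendsto.comp (tendsto_id.const_mul_atTop hT)
  have hk : ∀ v u, 0 ≤ T * fejK (T * (v - u)) := fun v u => mul_nonneg hT.le (fejK_nonneg _)
  refine tendsto_of_tendsto_of_tendsto_of_le_of_le' h1 tendsto_const_nhds ?_ ?_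
  · filter_upwards [eventually_ge_atTop 0] with v hv
    rw [← fejK_scaled_interval hT v v hv]
    apply setIntegral_mono_set (fejK_scaled_integrable hT v).integrableOn (Eventually.of_forall (hk v))
    apply Eventually.of_forall
    intro x hx
    have := hx.1
    simp at this
    exact this
  · filter_upwards with v
    rw [← fejK_scaled_total hT v]
    exact setIntegral_le_integral (fejK_scaled_integrable hT v) (Eventually.of_forall (hk v))

theorem wi_main {f : ℝ → ℝ} (hf : Measurable f) {M : ℝ} (hf0 : ∀ u, 0 ≤ f u) (hM : ∀ u, f u ≤ M)
    (hmono : ∀ u h, 0 ≤ h → f u ≤ Real.exp h * f (u + h)) {ρ : ℝ} {G : ℂ → ℂ}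
    (hG : ∀ s : ℂ, 0 < s.re → ∫ u in Ioi (0:ℝ), ((f u - ρ : ℝ) : ℂ) * Complex.exp (-s * u) = G s)
    (hGc : ContinuousOn G {s | 0 ≤ s.re}) : Tendsto f atTop (𝓝 ρ) := by
  set c := ∫ x, fejK x with hc
  have hcpos : 0 < c := fejK_pos_int
  have hM0 : 0 ≤ M := (hf0 0).trans (hM 0)
  have hfk : ∀ {T : ℝ} (hT : 0 < T) (v : ℝ), Integrable (fun u => f u * (T * fejK (T * (v - u)))) := by
    intro T hT v
    refine ((fejK_scaled_integrable hT v).const_mul M).mono' ?_ ?_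
    · have := fejK_meas
      apply Measurable.aestronglyMeasurable; fun_prop
    · filter_upwards with u
      have hk : 0 ≤ T * fejK (T * (v - u)) := mul_nonneg hT.le (fejK_nonneg _)
      rw [Real.norm_of_nonneg (mul_nonneg (hf0 u) hk)]
      exact mul_le_mul_of_nonneg_right (hM u) hk
  have hI : ∀ {T : ℝ}, 0 < T → Tendsto (fun v => ∫ u in Ioi (0:ℝ), f u * (T * fejK (T * (v - u)))) atTop (𝓝 (ρ * c)) := by
    intro T hT
    have h1 := wi_tendsto (e := fun u => f u - ρ) (hf.sub_const ρ) (M := M + |ρ|) (fun u => by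
      refine (abs_sub _ _).trans ?_
      rw [abs_of_nonneg (hf0 u)]; linarith [hM u]) hG hGc hT
    have h2 := (fejK_half_tendsto hT).const_mul ρ
    have := h1.add h2
    rw [zero_add] at this
    refine this.congr ?_
    intro v
    rw [← integral_const_mul, ← integral_add]
    · congr 1; ext u; ring
    · simp_rw [sub_mul]
      exact ((hfk hT v).sub ((fejK_scaled_integrable hT v).const_mul ρ)).integrableOn
    · exact ((fejK_scaled_integrable hT v).const_mul ρ).integrableOn
  -- sandwich
  have hlow : ∀ {T δ v : ℝ}, 0 < T → 0 ≤ δ → δ ≤ v → Real.exp (-(2 * δ)) * f (v - δ) * (∫ x in (-(T * δ))..(T * δ), fejK x) ≤ ∫ u in Ioi (0:ℝ), f u * (T * fejK (T * (v - u))) := by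
    intro T δ v hT hδ hv
    have hk : ∀ u, 0 ≤ T * fejK (T * (v - u)) := fun u => mul_nonneg hT.le (fejK_nonneg _)
    rw [← fejK_scaled_interval hT v δ hδ, ← integral_const_mul]
    calc _ ≤ ∫ u in Ioc (v - δ) (v + δ), f u * (T * fejK (T * (v - u))) := by
          apply setIntegral_mono_on _ (hfk hT v).integrableOn measurableSet_Ioc
          · intro u hu
            apply mul_le_mul_of_nonneg_right _ (hk u)
            have := hmono (v - δ) (u - (v - δ)) (by linarith [hu.1])
            rw [add_sub_cancel] at this
            have h3 : Real.exp (u - (v - δ)) ≤ Real.exp (2 * δ) := Real.exp_le_exp.2 (by linarith [hu.2])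
            have h4 : f (v - δ) ≤ Real.exp (2 * δ) * f u := this.trans (mul_le_mul_of_nonneg_right h3 (hf0 u))
            calc _ ≤ Real.exp (-(2 * δ)) * (Real.exp (2 * δ) * f u) := by gcongr
              _ = f u := by rw [← mul_assoc, ← Real.exp_add]; simp
          · exact ((fejK_scaled_integrable hT v).const_mul _).integrableOn
      _ ≤ _ := by
          apply setIntegral_mono_set (hfk hT v).integrableOn (Eventually.of_forall (fun u => mul_nonneg (hf0 u) (hk u)))
          apply Eventually.of_forall
          intro x hx
          have := hx.1
          change (0:ℝ) < x
          linarith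
  have hup : ∀ {T δ v : ℝ}, 0 < T → 0 ≤ δ → δ ≤ v → (∫ u in Ioi (0:ℝ), f u * (T * fejK (T * (v - u)))) ≤ Real.exp (2 * δ) * f (v + δ) * c + M * (c - ∫ x in (-(T * δ))..(T * δ), fejK x) := by
    intro T δ v hT hδ hv
    have hk : ∀ u, 0 ≤ T * fejK (T * (v - u)) := fun u => mul_nonneg hT.le (fejK_nonneg _)
    have hki := fejK_scaled_integrable hT v
    calc _ ≤ ∫ u, f u * (T * fejK (T * (v - u))) :=
          setIntegral_le_integral (hfk hT v) (Eventually.of_forall (fun u => mul_nonneg (hf0 u) (hk u)))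
      _ = (∫ u in Ioc (v - δ) (v + δ), f u * (T * fejK (T * (v - u)))) + ∫ u in (Ioc (v - δ) (v + δ))ᶜ, f u * (T * fejK (T * (v - u))) :=
          (integral_add_compl measurableSet_Ioc (hfk hT v)).symm
      _ ≤ (∫ u in Ioc (v - δ) (v + δ), (Real.exp (2 * δ) * f (v + δ)) * (T * fejK (T * (v - u)))) + ∫ u in (Ioc (v - δ) (v + δ))ᶜ, M * (T * fejK (T * (v - u))) := by
          apply add_le_add
          · apply setIntegral_mono_on (hfk hT v).integrableOn (hki.const_mul _).integrableOn measurableSet_Ioc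
            intro u hu
            apply mul_le_mul_of_nonneg_right _ (hk u)
            have := hmono u (v + δ - u) (by linarith [hu.2])
            rw [add_sub_cancel] at this
            have h3 : Real.exp (v + δ - u) ≤ Real.exp (2 * δ) := Real.exp_le_exp.2 (by linarith [hu.1])
            exact this.trans (mul_le_mul_of_nonneg_right h3 (hf0 _))
          · apply setIntegral_mono_on (hfk hT v).integrableOn (hki.const_mul _).integrableOn measurableSet_Ioc.compl
            intro u hu
            exact mul_le_mul_of_nonneg_right (hM u) (hk u)
      _ = Real.exp (2 * δ) * f (v + δ) * (∫ x in (-(T * δ))..(T * δ), fejK x) + M * (c - ∫ x in (-(T * δ))..(T * δ), fejK x) := by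
          rw [integral_const_mul (Real.exp (2 * δ) * f (v + δ)), integral_const_mul M, ← fejK_scaled_interval hT v δ hδ, hc, ← fejK_scaled_total hT v, ← integral_add_compl (measurableSet_Ioc (a := v - δ) (b := v + δ)) hki]
          ring
      _ ≤ _ := by
          gcongr
          · exact mul_nonneg (Real.exp_pos _).le (hf0 _)
          · exact fejK_cA_le _ (by positivity)
  have hca := fejK_cA_tendsto
  rw [← hc] at hca
  have hinv : Tendsto (fun A : ℝ => 2 * A⁻¹) atTop (𝓝 0) := by simpa using tendsto_inv_atTop_zero.const_mul (2:ℝ)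
  have e1 : Tendsto (fun A : ℝ => Real.exp (2 * A⁻¹)) atTop (𝓝 1) := by simpa [Function.comp_def] using (Real.continuous_exp.tendsto 0).comp hinv
  have e2 : Tendsto (fun A : ℝ => Real.exp (-(2 * A⁻¹))) atTop (𝓝 1) := by simpa [Function.comp_def] using (Real.continuous_exp.tendsto (-0)).comp hinv.neg
  have l1 : Tendsto (fun A : ℝ => Real.exp (2 * A⁻¹) * (ρ * c) / (∫ x in (-A)..A, fejK x)) atTop (𝓝 ρ) := by
    have := (e1.mul_const (ρ * c)).div hca hcpos.ne'
    convert! this using 2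
    field_simp
  have l2 : Tendsto (fun A : ℝ => Real.exp (-(2 * A⁻¹)) * (ρ * c - M * (c - ∫ x in (-A)..A, fejK x)) / c) atTop (𝓝 ρ) := by
    have := ((e2.mul ((hca.const_sub c).const_mul M |>.const_sub (ρ * c)))).div_const c
    convert! this using 2
    field_simp; ring
  rw [tendsto_order]
  constructor
  · intro a ha
    obtain ⟨A, hA, hA0⟩ := ((l2.eventually (lt_mem_nhds ha)).and (eventually_gt_atTop 0)).exists
    have hT : 0 < A ^ 2 := by positivity
    have hδ : A ^ 2 * A⁻¹ = A := by field_simp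
    have hlim : Tendsto (fun v => Real.exp (-(2 * A⁻¹)) * ((∫ u in Ioi (0:ℝ), f u * (A ^ 2 * fejK (A ^ 2 * (v - u)))) - M * (c - ∫ x in (-A)..A, fejK x)) / c) atTop (𝓝 (Real.exp (-(2 * A⁻¹)) * (ρ * c - M * (c - ∫ x in (-A)..A, fejK x)) / c)) :=
      (((hI hT).sub_const _).const_mul _).div_const _
    have hev := (hlim.eventually (lt_mem_nhds hA)).and (eventually_ge_atTop A⁻¹)
    have hsh : Tendsto (fun v : ℝ => v - A⁻¹) atTop atTop := tendsto_atTop_add_const_right _ _ tendsto_id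
    filter_upwards [hsh.eventually hev] with v hv
    refine hv.1.trans_le ?_
    have := hup hT (inv_pos.2 hA0).le hv.2
    rw [hδ, sub_add_cancel] at this
    rw [div_le_iff₀ hcpos]
    calc _ ≤ Real.exp (-(2 * A⁻¹)) * (Real.exp (2 * A⁻¹) * f v * c) := by
          gcongr; linarith
      _ = f v * c := by rw [mul_assoc, ← mul_assoc, ← Real.exp_add]; simp
  · intro b hb
    obtain ⟨A, ⟨hA, hA0⟩, hAc⟩ := (((l1.eventually (gt_mem_nhds hb)).and (eventually_gt_atTop 0)).and (hca.eventually (lt_mem_nhds hcpos))).exists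
    have hT : 0 < A ^ 2 := by positivity
    have hδ : A ^ 2 * A⁻¹ = A := by field_simp
    have hlim : Tendsto (fun v => Real.exp (2 * A⁻¹) * (∫ u in Ioi (0:ℝ), f u * (A ^ 2 * fejK (A ^ 2 * (v - u)))) / (∫ x in (-A)..A, fejK x)) atTop (𝓝 (Real.exp (2 * A⁻¹) * (ρ * c) / (∫ x in (-A)..A, fejK x))) :=
      ((hI hT).const_mul _).div_const _
    have hev := (hlim.eventually (gt_mem_nhds hA)).and (eventually_ge_atTop A⁻¹)
    have hsh : Tendsto (fun v : ℝ => v + A⁻¹) atTop atTop := tendsto_atTop_add_const_right _ _ tendsto_id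
    filter_upwards [hsh.eventually hev] with v hv
    refine lt_of_le_of_lt ?_ hv.1
    have := hlow hT (inv_pos.2 hA0).le hv.2
    rw [hδ, add_sub_cancel_right] at this
    rw [le_div_iff₀ hAc]
    calc f v * _ = Real.exp (2 * A⁻¹) * (Real.exp (-(2 * A⁻¹)) * f v * ∫ x in (-A)..A, fejK x) := by rw [← mul_assoc, ← mul_assoc, ← Real.exp_add]; simp
      _ ≤ _ := by gcongr
end

section
open Filter Topology MeasureTheory Set

theorem pnt_ap {q : ℕ} [NeZero q] {a : ZMod q} (ha : IsUnit a) :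
    Tendsto (fun x : ℝ => (∑ k ∈ Finset.Icc 1 ⌊x⌋₊, ArithmeticFunction.vonMangoldt.residueClass a k) / x) atTop (𝓝 ((q.totient : ℝ)⁻¹)) := by
  set S : ℝ → ℝ := fun x => ∑ k ∈ Finset.Icc 1 ⌊x⌋₊, ArithmeticFunction.vonMangoldt.residueClass a k with hS
  have hSmono : Monotone S := by
    intro x y hxy
    apply Finset.sum_le_sum_of_subset_of_nonneg
    · exact Finset.Icc_subset_Icc_right (Nat.floor_mono hxy)
    · intro k _ _; exact ArithmeticFunction.vonMangoldt.residueClass_nonneg a k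
  have hS0 : ∀ x, 0 ≤ S x := fun x => Finset.sum_nonneg fun k _ => ArithmeticFunction.vonMangoldt.residueClass_nonneg a k
  have hSle : ∀ x, 0 ≤ x → S x ≤ (Real.log 4 + 4) * x := by
    intro x hx
    refine le_trans ?_ (Chebyshev.psi_le_const_mul_self hx)
    rw [Chebyshev.psi]
    apply Finset.sum_le_sum
    intro k _
    exact ArithmeticFunction.vonMangoldt.residueClass_le a k
  have hO : (fun n : ℕ => ∑ k ∈ Finset.Icc 1 n, ArithmeticFunction.vonMangoldt.residueClass a k) =O[atTop] fun n ↦ (n : ℝ) ^ (1:ℝ) := by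
    apply Asymptotics.IsBigO.of_bound (Real.log 4 + 4)
    filter_upwards with n
    have h1 := hSle n (by positivity)
    have h2 := hS0 n
    simp only [hS, Nat.floor_natCast] at h1 h2
    rw [Real.rpow_one, Real.norm_of_nonneg h2, Real.norm_of_nonneg (by positivity)]
    exact h1
  set ρ : ℝ := (q.totient : ℝ)⁻¹ with hρ
  set f : ℝ → ℝ := fun u => Real.exp (-u) * S (Real.exp u) with hf
  have key : Tendsto f atTop (𝓝 ρ) := by
    refine wi_main (f := f) (M := Real.log 4 + 4) (G := fun s => (ArithmeticFunction.vonMangoldt.LFunctionResidueClassAux a (1 + s) - ρ) / (1 + s)) ?_ ?_ ?_ ?_ ?_ ?_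
    · have := hSmono.measurable
      fun_prop
    · intro u; exact mul_nonneg (Real.exp_pos _).le (hS0 _)
    · intro u
      calc f u ≤ Real.exp (-u) * ((Real.log 4 + 4) * Real.exp u) := by
            apply mul_le_mul_of_nonneg_left (hSle _ (Real.exp_pos _).le) (Real.exp_pos _).le
        _ = (Real.log 4 + 4) * (Real.exp (-u) * Real.exp u) := by ring
        _ = _ := by rw [← Real.exp_add]; simp
    · intro u h hh
      have : S (Real.exp u) ≤ S (Real.exp (u + h)) := hSmono (Real.exp_le_exp.2 (by linarith))
      calc f u ≤ Real.exp (-u) * S (Real.exp (u + h)) := mul_le_mul_of_nonneg_left this (Real.exp_pos _).le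
        _ = _ := by simp only [hf]; rw [← mul_assoc, ← Real.exp_add]; ring_nf
    · intro s hs
      have hs0 : s ≠ 0 := by rintro rfl; simp at hs
      have hw0 : 1 + s ≠ 0 := by
        intro h
        have := congrArg Complex.re h
        simp at this; linarith
      have hw : (1:ℝ) < (1 + s).re := by simp [hs]
      have hL := LSeries_eq_mul_integral_of_nonneg _ zero_le_one hw hO (ArithmeticFunction.vonMangoldt.residueClass_nonneg a)
      have hA := ArithmeticFunction.vonMangoldt.eqOn_LFunctionResidueClassAux ha hw
      simp only at hA
      rw [hL] at hA
      have himg : Set.image Real.exp (Ioi 0) = Ioi 1 := by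
        ext x; constructor
        · rintro ⟨u, hu, rfl⟩; simpa using hu
        · intro hx
          have hx1 : (1:ℝ) < x := hx
          exact ⟨Real.log x, Real.log_pos hx1, Real.exp_log (by linarith)⟩
      have hcv : ∫ t in Ioi (1:ℝ), (∑ k ∈ Finset.Icc 1 ⌊t⌋₊, ((ArithmeticFunction.vonMangoldt.residueClass a k : ℝ) : ℂ)) * (t:ℂ) ^ (-(1 + s + 1)) = ∫ u in Ioi (0:ℝ), (f u : ℂ) * Complex.exp (-s * u) := by
        rw [← himg, integral_image_eq_integral_abs_deriv_smul measurableSet_Ioi (fun x _ => (Real.hasDerivAt_exp x).hasDerivWithinAt) Real.exp_injective.injOn]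
        apply setIntegral_congr_fun measurableSet_Ioi
        intro u _
        simp only [hf, hS]
        rw [Real.abs_exp, Complex.real_smul, Complex.ofReal_exp, Complex.cpow_def_of_ne_zero (Complex.exp_ne_zero _), ← Complex.ofReal_exp, ← Complex.ofReal_log (Real.exp_pos _).le, Real.log_exp]
        push_cast
        have : Complex.exp u * Complex.exp (u * (-(1 + s + 1))) = Complex.exp (-u) * Complex.exp (-s * u) := by
          rw [← Complex.exp_add, ← Complex.exp_add]; ring_nf
        linear_combination (∑ k ∈ Finset.Icc 1 ⌊Real.exp u⌋₊, ((ArithmeticFunction.vonMangoldt.residueClass a k : ℝ) : ℂ)) * this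
      rw [hcv] at hA
      have hmeas : Measurable f := by
        have := hSmono.measurable
        fun_prop
      have hintg : ∀ g : ℝ → ℝ, Measurable g → (∀ u, |g u| ≤ Real.log 4 + 4 + |ρ|) → IntegrableOn (fun u : ℝ => (g u : ℂ) * Complex.exp (-s * u)) (Ioi 0) := by
        intro g hg hb
        refine ((integrableOn_exp_mul_Ioi (neg_lt_zero.2 hs) 0).const_mul (Real.log 4 + 4 + |ρ|)).mono' ?_ ?_
        · apply Measurable.aestronglyMeasurable; fun_prop
        · filter_upwards with u
          rw [norm_mul, Complex.norm_exp, Complex.norm_real, Real.norm_eq_abs]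
          have : (-s * (u:ℂ)).re = -s.re * u := by simp
          rw [this]
          gcongr
          exact hb u
      have hl4 : 0 ≤ Real.log 4 := Real.log_nonneg (by norm_num)
      have i1 := hintg f hmeas (by
        intro u
        have h1 : f u ≤ Real.log 4 + 4 := by
          calc f u ≤ Real.exp (-u) * ((Real.log 4 + 4) * Real.exp u) := by
                apply mul_le_mul_of_nonneg_left (hSle _ (Real.exp_pos _).le) (Real.exp_pos _).le
            _ = (Real.log 4 + 4) * (Real.exp (-u) * Real.exp u) := by ring
            _ = _ := by rw [← Real.exp_add]; simp
        rw [abs_of_nonneg (mul_nonneg (Real.exp_pos _).le (hS0 _))]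
        linarith [abs_nonneg ρ])
      have i2 := hintg (fun _ => ρ) measurable_const (by intro u; linarith)
      have : ∀ u : ℝ, ((f u - ρ : ℝ) : ℂ) * Complex.exp (-s * u) = (f u : ℂ) * Complex.exp (-s * u) - ρ * Complex.exp (-s * u) := by
        intro u; push_cast; ring
      simp_rw [this]
      rw [integral_sub i1 i2, integral_const_mul, integral_exp_mul_complex_Ioi (by simpa using hs), hA]
      simp only [hρ]
      push_cast
      simp
      field_simp
      ring
    · apply ContinuousOn.div
      · apply ContinuousOn.sub _ continuousOn_const
        apply (ArithmeticFunction.vonMangoldt.continuousOn_LFunctionResidueClassAux a).comp (by fun_prop)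
        intro s hs
        simp only [mem_ofPred_eq, Complex.add_re, Complex.one_re] at hs ⊢
        linarith
      · fun_prop
      · intro s hs h
        have := congrArg Complex.re h
        simp at this hs; linarith
  refine (key.comp Real.tendsto_log_atTop).congr' ?_
  filter_upwards [eventually_gt_atTop 0] with x hx
  simp only [Function.comp, hf]
  rw [Real.exp_neg, Real.exp_log hx]
  rw [← div_eq_inv_mul]
end

section
open Filter Topology MeasureTheory Set
open ArithmeticFunction (vonMangoldt)

noncomputable def ch (m : ℕ) : ℝ := ((ZMod.χ₄ (m : ZMod 4) : ℤ) : ℝ)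

lemma ch_mul (a b : ℕ) : ch (a * b) = ch a * ch b := by
  unfold ch; push_cast; rw [map_mul]; push_cast; rfl

lemma ch_nat (m : ℕ) : ch m = if m % 4 = 1 then 1 else if m % 4 = 3 then -1 else 0 := by
  unfold ch
  rw [ZMod.χ₄_nat_eq_if_mod_four]
  have : m % 4 < 4 := Nat.mod_lt _ (by norm_num)
  have h2 : m % 2 = (m % 4) % 2 := by omega
  rw [h2]
  interval_cases h : m % 4 <;> simp

lemma ch_abs_le (m : ℕ) : |ch m| ≤ 1 := by
  rw [ch_nat]; split_ifs <;> simp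

noncomputable def cL (m : ℕ) : ℝ := ch m * vonMangoldt m

lemma cL_abs_le (m : ℕ) : |cL m| ≤ vonMangoldt m := by
  unfold cL
  rw [abs_mul, abs_of_nonneg (ArithmeticFunction.vonMangoldt_nonneg)]
  have := ch_abs_le m
  have h2 := @ArithmeticFunction.vonMangoldt_nonneg m
  nlinarith

lemma cL_eq (m : ℕ) : cL m = ArithmeticFunction.vonMangoldt.residueClass (1 : ZMod 4) m - ArithmeticFunction.vonMangoldt.residueClass (3 : ZMod 4) m := by
  unfold cL
  rw [ch_nat]
  have e1 : ((m : ZMod 4) = 1) ↔ m % 4 = 1 := by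
    have : ((m : ZMod 4) = ((1:ℕ) : ZMod 4)) ↔ m % 4 = 1 % 4 := ZMod.natCast_eq_natCast_iff' m 1 4
    simpa using this
  have e3 : ((m : ZMod 4) = 3) ↔ m % 4 = 3 := by
    have : ((m : ZMod 4) = ((3:ℕ) : ZMod 4)) ↔ m % 4 = 3 % 4 := ZMod.natCast_eq_natCast_iff' m 3 4
    simpa using this
  simp only [ArithmeticFunction.vonMangoldt.residueClass, Set.indicator_apply, Set.mem_ofPred_eq, e1, e3]
  split_ifs with h1 h3 <;> first | omega | simp

noncomputable def psC (n : ℕ) : ℝ := ∑ m ∈ Finset.Ioc 0 n, cL m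

lemma psC_tendsto : Tendsto (fun n : ℕ => psC n / n) atTop (𝓝 0) := by
  have u3 : IsUnit (3 : ZMod 4) := by decide
  have h1 := pnt_ap (q := 4) (a := 1) isUnit_one
  have h3 := pnt_ap (q := 4) (a := 3) u3
  have h := (h1.sub h3).comp tendsto_natCast_atTop_atTop
  rw [sub_self] at h
  refine h.congr ?_
  intro n
  simp only [Function.comp, Nat.floor_natCast, psC]
  rw [← sub_div, ← Finset.sum_sub_distrib]
  congr 1
  apply Finset.sum_congr rfl
  intro m _
  rw [cL_eq]

lemma abel_id (c w : ℕ → ℝ) (a b : ℕ) (hab : a ≤ b) :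
    ∑ m ∈ Finset.Ioc a b, c m * w m = (∑ m ∈ Finset.Ioc 0 b, c m) * w b - (∑ m ∈ Finset.Ioc 0 a, c m) * w a
      + ∑ m ∈ Finset.Ico a b, (∑ j ∈ Finset.Ioc 0 m, c j) * (w m - w (m + 1)) := by
  induction b, hab using Nat.le_induction with
  | base => simp
  | succ b hab ih =>
    rw [Finset.sum_Ioc_succ_top (by omega), ih, Finset.sum_Ico_succ_top hab, Finset.sum_Ioc_succ_top (Nat.zero_le b)]
    ring

lemma sum_Ico_tele (w : ℕ → ℝ) (a b : ℕ) (hab : a ≤ b) : ∑ m ∈ Finset.Ico a b, (w m - w (m + 1)) = w a - w b := by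
  induction b, hab using Nat.le_induction with
  | base => simp
  | succ b hab ih => rw [Finset.sum_Ico_succ_top hab, ih]; ring

lemma ch_sum (n : ℕ) : ∑ m ∈ Finset.Ioc 0 n, ch m = if n % 4 = 1 ∨ n % 4 = 2 then 1 else 0 := by
  induction n with
  | zero => simp
  | succ n ih =>
    rw [Finset.sum_Ioc_succ_top (Nat.zero_le n), ih, ch_nat]
    have : n % 4 < 4 := Nat.mod_lt _ (by norm_num)
    have h2 : (n + 1) % 4 = (n % 4 + 1) % 4 := by omega
    rw [h2]
    interval_cases h : n % 4 <;> norm_num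

lemma ch_sum_bd (n : ℕ) : 0 ≤ ∑ m ∈ Finset.Ioc 0 n, ch m ∧ ∑ m ∈ Finset.Ioc 0 n, ch m ≤ 1 := by
  rw [ch_sum]; split_ifs <;> simp

lemma ch_abel_le (w : ℕ → ℝ) (a b : ℕ) (hab : a ≤ b) (hw : ∀ m, a ≤ m → w (m + 1) ≤ w m) (hw0 : ∀ m, a ≤ m → 0 ≤ w m) :
    ∑ m ∈ Finset.Ioc a b, ch m * w m ≤ w a - (∑ m ∈ Finset.Ioc 0 a, ch m) * w a := by
  rw [abel_id ch w a b hab]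
  have h1 : ∑ m ∈ Finset.Ico a b, (∑ j ∈ Finset.Ioc 0 m, ch j) * (w m - w (m + 1)) ≤ w a - w b := by
    rw [← sum_Ico_tele w a b hab]
    apply Finset.sum_le_sum
    intro m hm
    have := hw m (Finset.mem_Ico.1 hm).1
    have := (ch_sum_bd m).2
    nlinarith
  have := (ch_sum_bd b).2
  have := hw0 b hab
  nlinarith

lemma ch_abel_ge (w : ℕ → ℝ) (a b : ℕ) (hab : a ≤ b) (hw : ∀ m, a ≤ m → w (m + 1) ≤ w m) (hw0 : ∀ m, a ≤ m → 0 ≤ w m) :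
    - ((∑ m ∈ Finset.Ioc 0 a, ch m) * w a) ≤ ∑ m ∈ Finset.Ioc a b, ch m * w m := by
  rw [abel_id ch w a b hab]
  have h1 : 0 ≤ ∑ m ∈ Finset.Ico a b, (∑ j ∈ Finset.Ioc 0 m, ch j) * (w m - w (m + 1)) := by
    apply Finset.sum_nonneg
    intro m hm
    have := hw m (Finset.mem_Ico.1 hm).1
    have := (ch_sum_bd m).1
    apply mul_nonneg <;> linarith
  have := mul_nonneg (ch_sum_bd b).1 (hw0 b hab)
  linarith

noncomputable def X1 (k : ℕ) : ℝ := ∑ m ∈ Finset.Ioc 0 k, ch m * (1 / (m:ℝ))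

lemma X1_diff (a b : ℕ) (ha : 0 < a) (hab : a ≤ b) : |X1 b - X1 a| ≤ 1 / a := by
  have hs : X1 b - X1 a = ∑ m ∈ Finset.Ioc a b, ch m * (1 / (m:ℝ)) := by
    unfold X1
    rw [← Finset.sum_Ioc_consecutive _ (Nat.zero_le a) hab]; ring
  have hw : ∀ m : ℕ, a ≤ m → 1 / ((m + 1 : ℕ) : ℝ) ≤ 1 / (m:ℝ) := by
    intro m hm
    have : (0:ℝ) < m := by exact_mod_cast (by omega : 0 < m)
    apply one_div_le_one_div_of_le this
    push_cast; linarith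
  have h1 := ch_abel_le (fun m => 1 / (m:ℝ)) a b hab hw (fun m _ => by positivity)
  have h2 := ch_abel_ge (fun m => 1 / (m:ℝ)) a b hab hw (fun m _ => by positivity)
  have hb := ch_sum_bd a
  have hpos : (0:ℝ) ≤ 1 / a := by positivity
  rw [hs, abs_le]
  constructor <;> nlinarith [hb.1, hb.2]

lemma X1_even (k : ℕ) : X1 (2 * k) = ∑ i ∈ Finset.range k, (-1 : ℝ) ^ i / (2 * i + 1) := by
  induction k with
  | zero => simp [X1]
  | succ k ih =>
    rw [Finset.sum_range_succ, ← ih]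
    unfold X1
    rw [show 2 * (k + 1) = 2 * k + 1 + 1 by ring, Finset.sum_Ioc_succ_top (by omega), Finset.sum_Ioc_succ_top (by omega)]
    have h1 : ch (2 * k + 1 + 1) = 0 := by
      rw [ch_nat, if_neg (by omega), if_neg (by omega)]
    have h2 : ch (2 * k + 1) = (-1) ^ k := by
      rw [ch_nat]
      rcases Nat.even_or_odd k with h | h
      · rw [h.neg_one_pow, if_pos]
        obtain ⟨j, rfl⟩ := h; omega
      · rw [h.neg_one_pow, if_neg, if_pos]
        · obtain ⟨j, rfl⟩ := h; omega
        · obtain ⟨j, rfl⟩ := h; omega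
    rw [h1, h2]
    push_cast
    ring

lemma X1_bound (a : ℕ) (ha : 0 < a) : |Real.pi / 4 - X1 a| ≤ 1 / a := by
  have h : Tendsto (fun k => |X1 (2 * k) - X1 a|) atTop (𝓝 |Real.pi / 4 - X1 a|) := by
    simp_rw [X1_even]
    exact (Real.tendsto_sum_pi_div_four.sub_const _).abs
  apply le_of_tendsto h
  filter_upwards [eventually_ge_atTop a] with k hk
  exact X1_diff a (2 * k) ha (by omega)

noncomputable def afc : ArithmeticFunction ℝ := ⟨fun m => cL m * (1 / (m:ℝ)), by simp⟩
noncomputable def afx : ArithmeticFunction ℝ := ⟨fun m => ch m * (1 / (m:ℝ)), by simp⟩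

lemma af_conv (l : ℕ) : (afc * afx) l = ch l * (Real.log l / l) := by
  rw [ArithmeticFunction.mul_apply]
  rcases Nat.eq_zero_or_pos l with rfl | hl
  · simp
  rw [← ArithmeticFunction.vonMangoldt_sum, Finset.sum_div, Finset.mul_sum]
  rw [Nat.sum_divisorsAntidiagonal (fun i j => afc i * afx j)]
  apply Finset.sum_congr rfl
  intro i hi
  obtain ⟨⟨j, rfl⟩, -⟩ := Nat.mem_divisors.1 hi
  have hi0 : 0 < i := Nat.pos_of_mul_pos_right hl
  rw [Nat.mul_div_cancel_left j hi0, ch_mul]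
  simp only [afc, afx, ArithmeticFunction.coe_mk, cL]
  push_cast
  have : (i:ℝ) ≠ 0 := by positivity
  have : (j:ℝ) ≠ 0 := by rintro h; simp at h; subst h; simp at hl
  field_simp

lemma kernel_id (n : ℕ) : ∑ m ∈ Finset.Ioc 0 n, cL m * (1 / (m:ℝ)) * X1 (n / m) = ∑ l ∈ Finset.Ioc 0 n, ch l * (Real.log l / l) := by
  have := ArithmeticFunction.sum_Ioc_mul_eq_sum_sum afc afx n
  simp_rw [af_conv] at this
  rw [this]
  rfl
end

section
open Filter Topology MeasureTheory Set
open ArithmeticFunction (vonMangoldt)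

noncomputable def gk (n m : ℕ) : ℝ := ((n / m : ℕ) : ℝ) - (4 / Real.pi) * ((n:ℝ) * (1 / (m:ℝ))) * X1 (n / m)

lemma gk_bound (n m : ℕ) (hm : 0 < m) (hmn : m ≤ n) : |gk n m| ≤ 5 := by
  set k := n / m with hk
  have hk0 : 0 < k := Nat.div_pos hmn hm
  have hX := X1_bound k hk0
  have hm' : (0:ℝ) < m := by exact_mod_cast hm
  have hk' : (1:ℝ) ≤ k := by exact_mod_cast hk0
  set y : ℝ := (n:ℝ) * (1 / (m:ℝ)) with hy
  have hy1 : (k:ℝ) ≤ y := by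
    rw [hy, mul_one_div]; exact Nat.cast_div_le
  have hy2 : y ≤ k + 1 := by
    rw [hy, mul_one_div, div_le_iff₀ hm']
    have : n < (k + 1) * m := by rw [hk]; have := Nat.lt_mul_div_succ n hm; linarith [mul_comm m (n / m + 1)]
    exact_mod_cast this.le
  have hpi := Real.pi_gt_three
  unfold gk
  rw [← hk, ← hy]
  have hpk : |4 / Real.pi * y * (Real.pi / 4 - X1 k)| ≤ 4 := by
    rw [abs_mul]
    have h1 : |4 / Real.pi * y| ≤ 2 * (k + 1) := by
      rw [abs_of_nonneg (by positivity)]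
      have : 4 / Real.pi ≤ 2 := by rw [div_le_iff₀ (by positivity)]; linarith
      have : 0 < 4 / Real.pi := by positivity
      nlinarith
    calc _ ≤ 2 * ((k:ℝ) + 1) * (1 / k) := by gcongr
      _ ≤ 4 := by rw [mul_one_div, div_le_iff₀ (by linarith)]; linarith
  have e : (k:ℝ) - 4 / Real.pi * y * X1 k = (k - y) + 4 / Real.pi * y * (Real.pi / 4 - X1 k) := by
    field_simp; ring
  rw [e]
  rw [abs_le] at hpk ⊢
  constructor <;> linarith [hpk.1, hpk.2]

lemma psC_zero_div (k : ℕ) (hk : 0 < k) : Tendsto (fun n : ℕ => psC (n / k) / n) atTop (𝓝 0) := by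
  have h1 : Tendsto (fun n : ℕ => n / k) atTop atTop := Nat.tendsto_div_const_atTop hk.ne'
  have h2 := (psC_tendsto.comp h1).abs
  rw [abs_zero] at h2
  apply squeeze_zero_norm _ h2
  intro n
  simp only [Function.comp, Real.norm_eq_abs]
  rw [abs_div, abs_div, Nat.abs_cast, Nat.abs_cast]
  rcases Nat.eq_zero_or_pos (n / k) with h | h
  · rw [h]; simp [psC]
  · have hle : ((n / k : ℕ) : ℝ) ≤ n := by exact_mod_cast Nat.div_le_self n k
    have : (0:ℝ) < ((n / k : ℕ) : ℝ) := by exact_mod_cast h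
    gcongr

lemma M_diff (k : ℕ) (hk : 0 < k) : Tendsto (fun n : ℕ => ∑ m ∈ Finset.Ioc (n / (k + 1)) (n / k), cL m * (1 / (m:ℝ))) atTop (𝓝 0) := by
  rw [Metric.tendsto_atTop]
  intro ε hε
  have h := psC_tendsto
  rw [Metric.tendsto_atTop] at h
  obtain ⟨m0, hm0⟩ := h (ε / 10) (by positivity)
  have hb : ∀ m : ℕ, m0 ≤ m → 0 < m → |psC m| ≤ ε / 10 * m := by
    intro m hm hm1
    have := hm0 m hm
    rw [Real.dist_eq, sub_zero, abs_div, Nat.abs_cast, div_lt_iff₀ (by exact_mod_cast hm1)] at this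
    exact this.le
  refine ⟨(m0 + 1) * (k + 1), fun n hn => ?_⟩
  rw [Real.dist_eq, sub_zero]
  set a := n / (k + 1) with ha
  set b := n / k with hbb
  have ha1 : m0 + 1 ≤ a := by rw [ha, Nat.le_div_iff_mul_le (by omega)]; exact hn
  have hab : a ≤ b := Nat.div_le_div_left (by omega) hk
  have hba : b ≤ 4 * a := by
    have h1 : n < (k + 1) * (a + 1) := Nat.lt_mul_div_succ n (by omega)
    rw [hbb]
    apply Nat.div_le_of_le_mul
    nlinarith
  have ha' : (0:ℝ) < a := by exact_mod_cast (by omega : 0 < a)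
  have hb' : (0:ℝ) < b := by exact_mod_cast (by omega : 0 < b)
  rw [abel_id cL (fun m => 1 / (m:ℝ)) a b hab]
  have t1 : |psC b * (1 / (b:ℝ))| ≤ ε / 10 := by
    rw [abs_mul, abs_of_pos (by positivity : 0 < 1 / (b:ℝ)), mul_one_div, div_le_iff₀ hb']
    exact hb b (by omega) (by omega)
  have t2 : |psC a * (1 / (a:ℝ))| ≤ ε / 10 := by
    rw [abs_mul, abs_of_pos (by positivity : 0 < 1 / (a:ℝ)), mul_one_div, div_le_iff₀ ha']
    exact hb a (by omega) (by omega)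
  have t3 : |∑ m ∈ Finset.Ico a b, psC m * (1 / (m:ℝ) - 1 / ((m + 1 : ℕ) : ℝ))| ≤ ε / 10 * 3 := by
    refine (Finset.abs_sum_le_sum_abs _ _).trans ?_
    calc _ ≤ ∑ m ∈ Finset.Ico a b, ε / 10 * (1 / a) := by
          apply Finset.sum_le_sum
          intro m hm
          rw [Finset.mem_Ico] at hm
          have hm1 : (a:ℝ) ≤ m := by exact_mod_cast hm.1
          have hmp : (0:ℝ) < m := by linarith
          have e : 1 / (m:ℝ) - 1 / ((m + 1 : ℕ) : ℝ) = 1 / (m * (m + 1)) := by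
            push_cast; field_simp; ring
          rw [e, abs_mul, abs_of_pos (by positivity : 0 < 1 / ((m:ℝ) * (m + 1)))]
          calc _ ≤ (ε / 10 * m) * (1 / ((m:ℝ) * (m + 1))) := by
                gcongr; exact hb m (by omega) (by omega)
            _ = ε / 10 * (1 / (m + 1)) := by field_simp
            _ ≤ _ := by gcongr; linarith
      _ = (b - a : ℕ) * (ε / 10 * (1 / a)) := by simp
      _ ≤ (3 * a) * (ε / 10 * (1 / a)) := by
          gcongr
          exact_mod_cast (by omega : b - a ≤ 3 * a)
      _ = _ := by field_simp
  have e1 : ∀ x, psC x = ∑ m ∈ Finset.Ioc 0 x, cL m := fun _ => rfl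
  rw [← e1, ← e1]
  simp_rw [← e1]
  refine (abs_add_le _ _).trans_lt ?_
  have := abs_sub (psC b * (1 / (b:ℝ))) (psC a * (1 / (a:ℝ)))
  linarith

lemma block_tendsto (k : ℕ) (hk : 0 < k) : Tendsto (fun n : ℕ => (∑ m ∈ Finset.Ioc (n / (k + 1)) (n / k), cL m * gk n m) / n) atTop (𝓝 0) := by
  have h := (((psC_zero_div k hk).sub (psC_zero_div (k + 1) (by omega))).const_mul (k:ℝ)).sub ((M_diff k hk).const_mul ((4 / Real.pi) * X1 k))
  simp only [sub_zero, mul_zero] at h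
  refine h.congr' ?_
  filter_upwards [eventually_gt_atTop 0] with n hn
  have hn' : (n:ℝ) ≠ 0 := by positivity
  have hab : n / (k + 1) ≤ n / k := Nat.div_le_div_left (by omega) hk
  have e1 : psC (n / k) - psC (n / (k + 1)) = ∑ m ∈ Finset.Ioc (n / (k + 1)) (n / k), cL m := by
    unfold psC
    rw [← Finset.sum_Ioc_consecutive _ (Nat.zero_le _) hab]; ring
  rw [← sub_div, e1, eq_div_iff hn', sub_mul, mul_assoc, div_mul_cancel₀ _ hn', Finset.mul_sum, Finset.mul_sum, Finset.sum_mul, ← Finset.sum_sub_distrib]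
  apply Finset.sum_congr rfl
  intro m hm
  rw [Finset.mem_Ioc] at hm
  have hm0 : 0 < m := (Nat.zero_le _).trans_lt hm.1
  have hdiv : n / m = k := by
    apply Nat.div_eq_of_lt_le
    · have := (Nat.le_div_iff_mul_le hk).1 hm.2; linarith [mul_comm m k]
    · have := (Nat.div_lt_iff_lt_mul (by omega)).1 hm.1; linarith [mul_comm m (k+1)]
  unfold gk
  rw [hdiv]
  ring

lemma tail_split (n : ℕ) (F : ℕ → ℝ) (K : ℕ) : ∑ m ∈ Finset.Ioc 0 n, F m = ∑ m ∈ Finset.Ioc 0 (n / (K + 1)), F m + ∑ k ∈ Finset.range K, ∑ m ∈ Finset.Ioc (n / (k + 1 + 1)) (n / (k + 1)), F m := by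
  induction K with
  | zero => simp
  | succ K ih =>
    rw [Finset.sum_range_succ, ih, ← Finset.sum_Ioc_consecutive F (Nat.zero_le (n / (K + 1 + 1))) (Nat.div_le_div_left (by omega) (by omega) : n / (K + 1 + 1) ≤ n / (K + 1))]
    ring

lemma gk_tendsto : Tendsto (fun n : ℕ => (∑ m ∈ Finset.Ioc 0 n, cL m * gk n m) / n) atTop (𝓝 0) := by
  rw [Metric.tendsto_atTop]
  intro ε hε
  have hl4 : 0 ≤ Real.log 4 := Real.log_nonneg (by norm_num)
  obtain ⟨K, hK⟩ := exists_nat_gt (5 * (Real.log 4 + 4) / (ε / 2))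
  rw [div_lt_iff₀ (by positivity)] at hK
  have hfin : Tendsto (fun n : ℕ => ∑ k ∈ Finset.range K, (∑ m ∈ Finset.Ioc (n / (k + 1 + 1)) (n / (k + 1)), cL m * gk n m) / n) atTop (𝓝 0) := by
    have := tendsto_finsetSum (Finset.range K) (fun k _ => block_tendsto (k + 1) (by omega))
    simpa using this
  rw [Metric.tendsto_atTop] at hfin
  obtain ⟨n0, hn0⟩ := hfin (ε / 2) (by positivity)
  refine ⟨max n0 1, fun n hn => ?_⟩
  have hn1 : (0:ℝ) < n := by exact_mod_cast (by omega : 0 < n)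
  have h1 := hn0 n (by omega)
  rw [Real.dist_eq, sub_zero] at h1 ⊢
  rw [tail_split n _ K, add_div, Finset.sum_div (Finset.range K)]
  refine (abs_add_le _ _).trans_lt ?_
  have h2 : |(∑ m ∈ Finset.Ioc 0 (n / (K + 1)), cL m * gk n m) / n| ≤ ε / 2 := by
    rw [abs_div, Nat.abs_cast, div_le_iff₀ hn1]
    calc _ ≤ ∑ m ∈ Finset.Ioc 0 (n / (K + 1)), |cL m * gk n m| := Finset.abs_sum_le_sum_abs _ _
      _ ≤ ∑ m ∈ Finset.Ioc 0 (n / (K + 1)), vonMangoldt m * 5 := by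
          apply Finset.sum_le_sum
          intro m hm
          rw [Finset.mem_Ioc] at hm
          rw [abs_mul]
          have : m ≤ n := hm.2.trans (Nat.div_le_self _ _)
          exact mul_le_mul (cL_abs_le m) (gk_bound n m hm.1 this) (abs_nonneg _) ArithmeticFunction.vonMangoldt_nonneg
      _ = Chebyshev.psi ((n / (K + 1) : ℕ) : ℝ) * 5 := by
          rw [← Finset.sum_mul, Chebyshev.psi, Nat.floor_natCast]
      _ ≤ ((Real.log 4 + 4) * ((n / (K + 1) : ℕ) : ℝ)) * 5 := by
          gcongr; exact Chebyshev.psi_le_const_mul_self (by positivity)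
      _ ≤ ((Real.log 4 + 4) * ((n:ℝ) / (K + 1))) * 5 := by
          gcongr
          have := @Nat.cast_div_le ℝ _ _ _ n (K + 1)
          push_cast at this; exact this
      _ = (5 * (Real.log 4 + 4)) * n / (K + 1) := by ring
      _ ≤ _ := by
          rw [div_le_iff₀ (by positivity)]
          have : 5 * (Real.log 4 + 4) ≤ ε / 2 * (K + 1) := by nlinarith
          nlinarith
  linarith

lemma E_eq (n : ℕ) : ∑ m ∈ Finset.Ioc 0 n, cL m * ((n / m : ℕ) : ℝ) = (4 / Real.pi) * n * (∑ l ∈ Finset.Ioc 0 n, ch l * (Real.log l / l)) + ∑ m ∈ Finset.Ioc 0 n, cL m * gk n m := by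
  rw [← kernel_id, Finset.mul_sum, ← Finset.sum_add_distrib]
  apply Finset.sum_congr rfl
  intro m _
  unfold gk
  ring

lemma log_sum_le (n : ℕ) (hn : 25 ≤ n) : ∑ l ∈ Finset.Ioc 0 n, ch l * (Real.log l / l) ≤ ∑ l ∈ Finset.Ioc 0 25, ch l * (Real.log l / l) := by
  rw [← Finset.sum_Ioc_consecutive _ (Nat.zero_le 25) hn]
  have he : Real.exp 1 ≤ 3 := by have := Real.exp_one_lt_d9; linarith
  have h := ch_abel_le (fun m => Real.log m / m) 25 n hn (by
    intro m hm
    have hm' : (25:ℝ) ≤ m := by exact_mod_cast hm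
    have := Real.log_div_self_antitoneOn (a := (m:ℝ)) (b := ((m+1:ℕ):ℝ)) (by simp; linarith) (by simp; linarith) (by push_cast; linarith)
    exact this) (by
    intro m hm
    have hm' : (1:ℝ) ≤ m := by exact_mod_cast (by omega : 1 ≤ m)
    have := Real.log_nonneg hm'
    positivity)
  rw [ch_sum] at h
  norm_num at h ⊢
  linarith

lemma log_lower (a p q : ℕ) (hq : 0 < q) (h : 2 ^ p ≤ a ^ q) : (p:ℝ) / q * Real.log 2 ≤ Real.log a := by
  have h1 : ((2:ℝ)) ^ p ≤ (a:ℝ) ^ q := by exact_mod_cast h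
  have h2 := Real.log_le_log (by positivity) h1
  rw [Real.log_pow, Real.log_pow] at h2
  have : (0:ℝ) < q := by exact_mod_cast hq
  rw [div_mul_eq_mul_div, div_le_iff₀ this]; linarith

lemma log_upper (a p q : ℕ) (ha : 0 < a) (hq : 0 < q) (h : a ^ q ≤ 2 ^ p) : Real.log a ≤ (p:ℝ) / q * Real.log 2 := by
  have h1 : (a:ℝ) ^ q ≤ ((2:ℝ)) ^ p := by exact_mod_cast h
  have h2 := Real.log_le_log (by positivity) h1
  rw [Real.log_pow, Real.log_pow] at h2
  have : (0:ℝ) < q := by exact_mod_cast hq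
  rw [div_mul_eq_mul_div, le_div_iff₀ this]; linarith

lemma S25 : ∑ l ∈ Finset.Ioc 0 25, ch l * (Real.log l / l) ≤ -0.125 := by
  have h2 := Real.log_two_gt_d9
  have h3 := log_lower 3 19 12 (by norm_num) (by norm_num)
  have h7 := log_lower 7 14 5 (by norm_num) (by norm_num)
  have h11 := log_lower 11 38 11 (by norm_num) (by norm_num)
  have h19 := log_lower 19 55 13 (by norm_num) (by norm_num)
  have h23 := log_lower 23 9 2 (by norm_num) (by norm_num)
  have h5 := log_upper 5 72 31 (by norm_num) (by norm_num) (by norm_num)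
  have h13 := log_upper 13 63 17 (by norm_num) (by norm_num) (by norm_num)
  have h17 := log_upper 17 45 11 (by norm_num) (by norm_num) (by norm_num)
  have l9 : Real.log 9 = 2 * Real.log 3 := by rw [show (9:ℝ) = 3 ^ 2 by norm_num, Real.log_pow]; norm_num
  have l25 : Real.log 25 = 2 * Real.log 5 := by rw [show (25:ℝ) = 5 ^ 2 by norm_num, Real.log_pow]; norm_num
  have l15 : Real.log 15 = Real.log 3 + Real.log 5 := by rw [show (15:ℝ) = 3 * 5 by norm_num, Real.log_mul] <;> norm_num
  have l21 : Real.log 21 = Real.log 3 + Real.log 7 := by rw [show (21:ℝ) = 3 * 7 by norm_num, Real.log_mul] <;> norm_num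
  simp only [show Finset.Ioc 0 25 = {1,2,3,4,5,6,7,8,9,10,11,12,13,14,15,16,17,18,19,20,21,22,23,24,25} by decide]
  simp [ch_nat]
  push_cast at *
  rw [l9, l25, l15, l21]
  linarith

theorem E_bound : ∀ᶠ n : ℕ in atTop, ∑ m ∈ Finset.Ioc 0 n, cL m * ((n / m : ℕ) : ℝ) ≤ -0.155 * n := by
  have h := gk_tendsto.eventually (gt_mem_nhds (by norm_num : (0:ℝ) < 0.004))
  filter_upwards [h, eventually_ge_atTop 25] with n hn hn25
  have hn' : (0:ℝ) < n := by exact_mod_cast (by omega : 0 < n)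
  rw [div_lt_iff₀ hn'] at hn
  rw [E_eq]
  have h1 := (log_sum_le n hn25).trans S25
  have hpi : 0.159 ≤ 4 / Real.pi * 0.125 := by
    have := Real.pi_lt_d2
    rw [div_mul_eq_mul_div, le_div_iff₀ Real.pi_pos]
    norm_num at this ⊢; linarith [Real.pi_lt_d4]
  have h2 : 4 / Real.pi * n * (∑ l ∈ Finset.Ioc 0 n, ch l * (Real.log l / l)) ≤ 4 / Real.pi * n * (-0.125) := by
    gcongr
  nlinarith
end

section
open Filter Topology MeasureTheory Set
open ArithmeticFunction (vonMangoldt)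

lemma log_fact_eq (n : ℕ) : Real.log (n.factorial : ℝ) = ∑ m ∈ Finset.Ioc 0 n, vonMangoldt m * ((n / m : ℕ) : ℝ) := by
  have h := ArithmeticFunction.sum_Ioc_mul_zeta_eq_sum vonMangoldt n
  rw [ArithmeticFunction.vonMangoldt_mul_zeta] at h
  rw [← h]
  induction n with
  | zero => simp
  | succ n ih =>
    rw [Finset.sum_Ioc_succ_top (Nat.zero_le n), ← ih (ArithmeticFunction.vonMangoldt_mul_zeta ▸ ArithmeticFunction.sum_Ioc_mul_zeta_eq_sum vonMangoldt n), Nat.factorial_succ]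
    push_cast
    rw [Real.log_mul (by positivity) (by positivity), ArithmeticFunction.log_apply]
    push_cast
    ring

lemma log_fact_le (n : ℕ) (hn : 1 ≤ n) : Real.log (n.factorial : ℝ) ≤ n * Real.log n - n + Real.log n + 1 := by
  induction n, hn using Nat.le_induction with
  | base => simp
  | succ n hn ih =>
    have hn' : (0:ℝ) < n := by exact_mod_cast hn
    rw [Nat.factorial_succ]
    push_cast
    rw [Real.log_mul (by positivity) (by positivity)]
    have h := Real.one_sub_inv_le_log_of_pos (show (0:ℝ) < (n + 1) / n by positivity)
    rw [Real.log_div (by positivity) (by positivity)] at h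
    have h2 : ((n:ℝ) + 1) * (1 - (((n:ℝ) + 1) / n)⁻¹) = 1 := by field_simp; ring
    have h3 := mul_le_mul_of_nonneg_left h (by positivity : (0:ℝ) ≤ n + 1)
    rw [h2] at h3
    nlinarith

lemma logM_le (M n : ℕ) (hM : M ≠ 0)
    (h : ∀ p : ℕ, p.Prime → (M.factorization p : ℝ) ≤ ∑ k ∈ Finset.Icc 1 n, (1 + ch (p ^ k)) * ((n / p ^ k : ℕ) : ℝ)) :
    Real.log M ≤ Real.log (n.factorial : ℝ) + ∑ m ∈ Finset.Ioc 0 n, cL m * ((n / m : ℕ) : ℝ) := by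
  rw [log_fact_eq, ← Finset.sum_add_distrib]
  have e : ∀ m ∈ Finset.Ioc 0 n, vonMangoldt m * ((n / m : ℕ) : ℝ) + cL m * ((n / m : ℕ) : ℝ) = vonMangoldt m * ((1 + ch m) * ((n / m : ℕ) : ℝ)) := by
    intro m _; unfold cL; ring
  rw [Finset.sum_congr rfl e]
  set F : ℕ → ℝ := fun m => (1 + ch m) * ((n / m : ℕ) : ℝ) with hF
  have hF0 : ∀ m, 0 ≤ F m := fun m => mul_nonneg (by have := (abs_le.1 (ch_abs_le m)).1; linarith) (by positivity)
  have hFn : ∀ m, n < m → F m = 0 := fun m hm => by simp [hF, Nat.div_eq_of_lt hm]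
  rw [Real.log_nat_eq_sum_factorization, Finsupp.sum]
  set P := M.factorization.support with hP
  have hPp : ∀ p ∈ P, p.Prime := fun p hp => Nat.prime_of_mem_primeFactors (by simpa [hP] using hp)
  calc ∑ p ∈ P, (M.factorization p : ℝ) * Real.log p ≤ ∑ p ∈ P, ∑ k ∈ Finset.Icc 1 n, vonMangoldt (p ^ k) * F (p ^ k) := by
        apply Finset.sum_le_sum
        intro p hp
        have hpp := hPp p hp
        have hl : 0 ≤ Real.log p := Real.log_natCast_nonneg p
        calc _ ≤ (∑ k ∈ Finset.Icc 1 n, F (p ^ k)) * Real.log p := mul_le_mul_of_nonneg_right (h p hpp) hl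
          _ = _ := by
            rw [Finset.sum_mul]
            apply Finset.sum_congr rfl
            intro k hk
            have hk1 := (Finset.mem_Icc.1 hk).1
            rw [ArithmeticFunction.vonMangoldt_apply_pow (by omega), ArithmeticFunction.vonMangoldt_apply_prime hpp, mul_comm]
    _ = ∑ x ∈ P ×ˢ Finset.Icc 1 n, vonMangoldt (x.1 ^ x.2) * F (x.1 ^ x.2) := by rw [Finset.sum_product]
    _ = ∑ x ∈ (P ×ˢ Finset.Icc 1 n).filter (fun x => x.1 ^ x.2 ≤ n), vonMangoldt (x.1 ^ x.2) * F (x.1 ^ x.2) := by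
        symm
        apply Finset.sum_filter_of_ne
        intro x _ hx
        by_contra hlt
        rw [hFn _ (by omega), mul_zero] at hx
        exact hx rfl
    _ = ∑ m ∈ ((P ×ˢ Finset.Icc 1 n).filter (fun x => x.1 ^ x.2 ≤ n)).image (fun x => x.1 ^ x.2), vonMangoldt m * F m := by
        rw [Finset.sum_image]
        intro x hx y hy hxy
        simp only [Finset.coe_filter, Finset.mem_product, Finset.mem_Icc, Set.mem_ofPred_eq] at hx hy
        have := (hPp _ hx.1.1).pow_inj' (hPp _ hy.1.1) (by omega) (by omega) hxy
        exact Prod.ext this.1 this.2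
    _ ≤ _ := by
        apply Finset.sum_le_sum_of_subset_of_nonneg
        · intro m hm
          simp only [Finset.mem_image, Finset.mem_filter, Finset.mem_product, Finset.mem_Icc] at hm
          obtain ⟨x, ⟨⟨h1, h2⟩, h3⟩, rfl⟩ := hm
          rw [Finset.mem_Ioc]
          exact ⟨Nat.pow_pos (hPp _ h1).pos, h3⟩
        · intro m _ _
          exact mul_nonneg ArithmeticFunction.vonMangoldt_nonneg (hF0 m)
end

section
open Filter Topology MeasureTheory Set

lemma greedy_pt (q : GaussianInt) (R : Finset GaussianInt) (hq : q ≠ 0) (hR : ∀ a ∈ R, ∀ b ∈ R, q ∣ a - b → a = b)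
    (hR0 : R.Nonempty) (T : Finset GaussianInt) (K : ℕ) :
    ∃ z : GaussianInt, ∀ k ≤ K, (open Classical in (T.filter (fun t => q ^ k ∣ z - t)).card) * R.card ^ k ≤ T.card := by
  classical
  induction K with
  | zero =>
    refine ⟨0, fun k hk => ?_⟩
    obtain rfl : k = 0 := by omega
    simpa using Finset.card_filter_le _ _
  | succ K ih =>
    obtain ⟨z, hz⟩ := ih
    set A : GaussianInt → Finset GaussianInt := fun w => T.filter (fun t => q ^ (K+1) ∣ z + q ^ K * w - t) with hA
    have hsub : R.biUnion A ⊆ T.filter (fun t => q ^ K ∣ z - t) := by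
      intro t ht
      simp only [hA, Finset.mem_biUnion, Finset.mem_filter] at ht ⊢
      obtain ⟨w, _, h1, h2⟩ := ht
      refine ⟨h1, ?_⟩
      have h3 : q ^ K ∣ z + q ^ K * w - t := (pow_dvd_pow q (Nat.le_succ K)).trans h2
      have : z - t = (z + q ^ K * w - t) - q ^ K * w := by ring
      rw [this]
      exact dvd_sub h3 (Dvd.intro _ rfl)
    have hdisj : Set.PairwiseDisjoint (R : Set GaussianInt) A := by
      intro a ha b hb hab
      rw [Function.onFun, Finset.disjoint_left]
      intro t h1 h2
      simp only [hA, Finset.mem_filter] at h1 h2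
      apply hab
      apply hR a ha b hb
      have h3 := dvd_sub h1.2 h2.2
      have h4 : (z + q ^ K * a - t) - (z + q ^ K * b - t) = q ^ K * (a - b) := by ring
      rw [h4, pow_succ] at h3
      exact (mul_dvd_mul_iff_left (pow_ne_zero K hq)).1 h3
    have hcard := Finset.card_le_card hsub
    rw [Finset.card_biUnion hdisj] at hcard
    obtain ⟨w, hw, hmin⟩ := Finset.exists_min_image R (fun w => (A w).card) hR0
    have h1 : R.card * (A w).card ≤ ∑ u ∈ R, (A u).card := by
      simpa using Finset.card_nsmul_le_sum R (fun u => (A u).card) _ hmin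
    refine ⟨z + q ^ K * w, fun k hk => ?_⟩
    rcases Nat.lt_or_ge k (K+1) with h | h
    · have : (T.filter (fun t => q ^ k ∣ z + q ^ K * w - t)) = T.filter (fun t => q ^ k ∣ z - t) := by
        apply Finset.filter_congr
        intro t _
        have h5 : z + q ^ K * w - t = (z - t) + q ^ K * w := by ring
        rw [h5]
        exact dvd_add_left (Dvd.dvd.mul_right (pow_dvd_pow q (by omega)) w)
      rw [this]
      exact hz k (by omega)
    · obtain rfl : k = K + 1 := by omega
      have h2 := hz K le_rfl
      calc (A w).card * R.card ^ (K+1) = (R.card * (A w).card) * R.card ^ K := by ring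
        _ ≤ _ := (Nat.mul_le_mul_right _ (h1.trans hcard)).trans h2

lemma vbound (q : GaussianInt) (hq : Prime q) (R : Finset GaussianInt) (hR : ∀ a ∈ R, ∀ b ∈ R, q ∣ a - b → a = b)
    (hR2 : 2 ≤ R.card) (T : Finset GaussianInt) (P : GaussianInt) (hP : ∀ z, P ∣ ∏ t ∈ T, (z - t)) (e : ℕ)
    (he : q ^ e ∣ P) : e ≤ ∑ k ∈ Finset.Icc 1 T.card, T.card / R.card ^ k := by
  classical
  obtain ⟨z, hz⟩ := greedy_pt q R hq.ne_zero hR (Finset.card_pos.1 (by omega)) T (T.card + 1)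
  have hz' : ∀ k ≤ T.card + 1, (T.filter (fun t => q ^ k ∣ z - t)).card ≤ T.card / R.card ^ k := by
    intro k hk
    rw [Nat.le_div_iff_mul_le (by positivity)]
    convert hz k hk
  have hK : ∀ t ∈ T, ¬ q ^ (T.card + 1) ∣ z - t := by
    have h1 := hz' (T.card + 1) le_rfl
    have h2 : T.card < R.card ^ (T.card + 1) := (Nat.lt_succ_self _).trans (Nat.lt_pow_self (by omega))
    rw [Nat.div_eq_of_lt h2] at h1
    have h3 := Finset.card_eq_zero.1 (Nat.le_zero.1 h1)
    rw [Finset.filter_eq_empty_iff] at h3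
    intro t ht
    exact h3 ht
  have h1 := pow_dvd_iff_le_emultiplicity.1 (he.trans (hP z))
  rw [Finset.emultiplicity_prod hq] at h1
  have h2 : ∀ t ∈ T, emultiplicity q (z - t) ≤ (((Finset.Icc 1 T.card).filter (fun k => q ^ k ∣ z - t)).card : ℕ∞) := by
    intro t ht
    have hf : emultiplicity q (z - t) < ((T.card + 1 : ℕ) : ℕ∞) := emultiplicity_lt_iff_not_dvd.2 (hK t ht)
    obtain ⟨m, hm⟩ := ENat.ne_top_iff_exists.1 (ne_top_of_lt hf)
    rw [← hm] at hf ⊢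
    have hm' : m < T.card + 1 := by exact_mod_cast hf
    have hd : q ^ m ∣ z - t := pow_dvd_iff_le_emultiplicity.2 hm.le
    norm_cast
    calc m = (Finset.Icc 1 m).card := by simp
      _ ≤ _ := Finset.card_le_card (by
        intro k hk
        rw [Finset.mem_Icc] at hk
        rw [Finset.mem_filter, Finset.mem_Icc]
        exact ⟨⟨hk.1, by omega⟩, (pow_dvd_pow q hk.2).trans hd⟩)
  have h3 := h1.trans (Finset.sum_le_sum h2)
  have h4 : e ≤ ∑ t ∈ T, ((Finset.Icc 1 T.card).filter (fun k => q ^ k ∣ z - t)).card := by exact_mod_cast h3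
  calc e ≤ _ := h4
    _ = ∑ k ∈ Finset.Icc 1 T.card, (T.filter (fun t => q ^ k ∣ z - t)).card := by
      simp only [Finset.card_filter]
      rw [Finset.sum_comm]
    _ ≤ _ := Finset.sum_le_sum (fun k hk => hz' k (by have := (Finset.mem_Icc.1 hk).2; omega))
end

section
open Filter Topology MeasureTheory Set

lemma split_pow (q a b : GaussianInt) (hq : Prime q) (e : ℕ) (h : q ^ e ∣ a * b) : ∃ i j, i + j = e ∧ q ^ i ∣ a ∧ q ^ j ∣ b := by
  obtain ⟨d1, d2, h1, h2, h3⟩ := exists_dvd_and_dvd_of_dvd_mul h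
  obtain ⟨i, j, b', c', hij, hbc, rfl, rfl⟩ := mul_eq_mul_prime_pow (x := d1) (y := d2) hq (a := 1) (n := e) (by rw [one_mul]; exact h3.symm)
  exact ⟨i, j, hij, (Dvd.intro_left _ rfl).trans h1, (Dvd.intro_left _ rfl).trans h2⟩

lemma star_dvd_of (a b : GaussianInt) (h : a ∣ star b) : star a ∣ b := by
  obtain ⟨c, hc⟩ := h
  refine ⟨star c, ?_⟩
  rw [← star_star b, hc, star_mul, mul_comm]

lemma pow_dvd_norm (P : GaussianInt) (p : ℕ) : (p : GaussianInt) ^ ((Zsqrtd.norm P).natAbs.factorization p) ∣ P * star P := by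
  rw [← Zsqrtd.norm_eq_mul_conj]
  have h := Nat.ordProj_dvd (Zsqrtd.norm P).natAbs p
  have h2 : ((p ^ ((Zsqrtd.norm P).natAbs.factorization p) : ℕ) : ℤ) ∣ Zsqrtd.norm P := by
    rw [← Int.natCast_dvd_natCast] at h
    exact h.trans (Int.natAbs_dvd.2 dvd_rfl)
  have h3 := (Zsqrtd.intCast_dvd_intCast (d := -1) _ _).2 h2
  push_cast at h3
  exact h3

lemma prime_of_norm (π : GaussianInt) (p : ℕ) (hp : p.Prime) (h : Zsqrtd.norm π = p) : Prime π := by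
  rw [← irreducible_iff_prime]
  constructor
  · intro hu
    rw [← Zsqrtd.norm_eq_one_iff, h] at hu
    simp only [Int.natAbs_natCast] at hu
    exact hp.one_lt.ne' hu
  · intro a b hab
    have h1 : a.norm.natAbs * b.norm.natAbs = p := by
      rw [← Int.natAbs_mul, ← Zsqrtd.norm_mul, ← hab, h]; simp
    rw [← Zsqrtd.norm_eq_one_iff, ← Zsqrtd.norm_eq_one_iff]
    have h2 : a.norm.natAbs ∣ p := Dvd.intro _ h1
    rcases (Nat.dvd_prime hp).1 h2 with h3 | h3
    · exact Or.inl h3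
    · right
      rw [h3] at h1
      exact Nat.eq_of_mul_eq_mul_left hp.pos (by omega)

/-- split prime residues -/
lemma vbound_split (π : GaussianInt) (p : ℕ) (hp : p.Prime) (h : Zsqrtd.norm π = p)
    (T : Finset GaussianInt) (P : GaussianInt) (hP : ∀ z, P ∣ ∏ t ∈ T, (z - t)) (e : ℕ)
    (he : π ^ e ∣ P) : e ≤ ∑ k ∈ Finset.Icc 1 T.card, T.card / p ^ k := by
  classical
  have hinj : Function.Injective (fun m : ℕ => (m : GaussianInt)) := Nat.cast_injective
  have hc : ((Finset.range p).image (fun m : ℕ => (m : GaussianInt))).card = p := by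
    rw [Finset.card_image_of_injective _ hinj, Finset.card_range]
  have := vbound π (prime_of_norm π p hp h) ((Finset.range p).image (fun m : ℕ => (m : GaussianInt))) ?_ (by rw [hc]; exact hp.two_le) T P hP e he
  · rwa [hc] at this
  · intro a ha b hb hab
    simp only [Finset.mem_image, Finset.mem_range] at ha hb
    obtain ⟨x, hx, rfl⟩ := ha
    obtain ⟨y, hy, rfl⟩ := hb
    obtain ⟨c, hcc⟩ := hab
    have h1 := congrArg Zsqrtd.norm hcc
    rw [Zsqrtd.norm_mul, h] at h1
    have h2 : ((x : GaussianInt) - y) = (((x : ℤ) - y : ℤ) : GaussianInt) := by push_cast; rfl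
    rw [h2, Zsqrtd.norm_intCast] at h1
    have h3 : (p : ℤ) ∣ ((x : ℤ) - y) * ((x : ℤ) - y) := ⟨_, h1⟩
    have h4 : (p : ℤ) ∣ (x : ℤ) - y := by
      rcases (Nat.prime_iff_prime_int.1 hp).dvd_or_dvd h3 with h | h <;> exact h
    obtain ⟨d, hd⟩ := h4
    have : (x : ℤ) = y := by
      have hd0 : d = 0 := by
        by_contra hne
        rcases lt_or_gt_of_ne hne with h5 | h5 <;> nlinarith
      rw [hd0] at hd; linarith
    have : x = y := by exact_mod_cast this
    rw [this]

lemma vbound_inert (p : ℕ) (hp : p.Prime) (h : Prime (p : GaussianInt))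
    (T : Finset GaussianInt) (P : GaussianInt) (hP : ∀ z, P ∣ ∏ t ∈ T, (z - t)) (e : ℕ)
    (he : (p : GaussianInt) ^ e ∣ P) : e ≤ ∑ k ∈ Finset.Icc 1 T.card, T.card / p ^ (2 * k) := by
  classical
  set f : ℕ × ℕ → GaussianInt := fun x => ⟨x.1, x.2⟩ with hf
  have hinj : Function.Injective f := by
    intro x y hxy
    simp only [hf, Zsqrtd.mk.injEq] at hxy
    exact Prod.ext (by exact_mod_cast hxy.1) (by exact_mod_cast hxy.2)
  have hc : ((Finset.range p ×ˢ Finset.range p).image f).card = p ^ 2 := by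
    rw [Finset.card_image_of_injective _ hinj, Finset.card_product, Finset.card_range, sq]
  have key : ∀ x y : ℕ, x < p → y < p → (p : ℤ) ∣ (x : ℤ) - y → x = y := by
    intro x y hx hy h4
    obtain ⟨d, hd⟩ := h4
    have : (x : ℤ) = y := by
      have hd0 : d = 0 := by
        by_contra hne
        rcases lt_or_gt_of_ne hne with h5 | h5 <;> nlinarith
      rw [hd0] at hd; linarith
    exact_mod_cast this
  have := vbound p h ((Finset.range p ×ˢ Finset.range p).image f) ?_ (by rw [hc]; nlinarith [hp.two_le]) T P hP e he
  · rw [hc] at this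
    simpa only [← pow_mul] using this
  · intro a ha b hb hab
    simp only [Finset.mem_image, Finset.mem_product, Finset.mem_range] at ha hb
    obtain ⟨x, hx, rfl⟩ := ha
    obtain ⟨y, hy, rfl⟩ := hb
    have h2 : ((p : ℕ) : GaussianInt) = ((p : ℤ) : GaussianInt) := by push_cast; rfl
    rw [h2, Zsqrtd.intCast_dvd] at hab
    simp only [hf, Zsqrtd.re_sub, Zsqrtd.im_sub] at hab
    have e1 := key _ _ hx.1 hy.1 hab.1
    have e2 := key _ _ hx.2 hy.2 hab.2
    rw [show x = y from Prod.ext e1 e2]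

lemma ch_pow (p k : ℕ) : ch (p ^ k) = ch p ^ k := by
  induction k with
  | zero => rw [pow_zero, pow_zero, ch_nat]; norm_num
  | succ k ih => rw [pow_succ, ch_mul, ih, pow_succ]

lemma fact_bound (T : Finset GaussianInt) (P : GaussianInt) (hP : ∀ z, P ∣ ∏ t ∈ T, (z - t)) (p : ℕ) (hp : p.Prime) :
    ((Zsqrtd.norm P).natAbs.factorization p : ℝ) ≤ ∑ k ∈ Finset.Icc 1 T.card, (1 + ch (p ^ k)) * ((T.card / p ^ k : ℕ) : ℝ) := by
  haveI : Fact p.Prime := ⟨hp⟩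
  have hd := pow_dvd_norm P p
  set e := (Zsqrtd.norm P).natAbs.factorization p with he
  have hstarp : ∀ j, star ((p : GaussianInt) ^ j) = (p : GaussianInt) ^ j := by intro j; rw [star_pow]; simp
  have h4 : p % 4 < 4 := Nat.mod_lt _ (by norm_num)
  by_cases h3 : p % 4 = 3
  · have hpr := GaussianInt.prime_of_nat_prime_of_mod_four_eq_three p h3
    obtain ⟨i, j, hij, hi, hj⟩ := split_pow _ _ _ hpr e hd
    have hj' := star_dvd_of _ _ hj
    rw [hstarp] at hj'
    have b1 := vbound_inert p hp hpr T P hP i hi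
    have b2 := vbound_inert p hp hpr T P hP j hj'
    have hch : ch p = -1 := by rw [ch_nat, h3]; norm_num
    have b3 : (e : ℝ) ≤ 2 * ∑ k ∈ Finset.Icc 1 T.card, ((T.card / p ^ (2 * k) : ℕ) : ℝ) := by
      have : e ≤ 2 * ∑ k ∈ Finset.Icc 1 T.card, T.card / p ^ (2 * k) := by omega
      exact_mod_cast this
    refine b3.trans ?_
    rw [Finset.mul_sum]
    set n := T.card
    calc ∑ k ∈ Finset.Icc 1 n, 2 * ((n / p ^ (2 * k) : ℕ) : ℝ)
        = ∑ k ∈ (Finset.Icc 1 n).filter (fun k => 2 * k ≤ n), 2 * ((n / p ^ (2 * k) : ℕ) : ℝ) := by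
          symm
          apply Finset.sum_filter_of_ne
          intro k hk hne
          by_contra hlt
          apply hne
          have : n < p ^ (2 * k) := (not_le.1 hlt).trans (Nat.lt_pow_self hp.one_lt)
          rw [Nat.div_eq_of_lt this]; simp
      _ = ∑ m ∈ ((Finset.Icc 1 n).filter (fun k => 2 * k ≤ n)).image (fun k => 2 * k), (1 + ch (p ^ m)) * ((n / p ^ m : ℕ) : ℝ) := by
          rw [Finset.sum_image (by intro x _ y _ hxy; simpa using hxy)]
          apply Finset.sum_congr rfl
          intro k _
          rw [ch_pow, hch, pow_mul]; norm_num
      _ ≤ _ := by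
          apply Finset.sum_le_sum_of_subset_of_nonneg
          · intro m hm
            simp only [Finset.mem_image, Finset.mem_filter, Finset.mem_Icc] at hm
            obtain ⟨k, ⟨⟨h1, h2⟩, h3⟩, rfl⟩ := hm
            rw [Finset.mem_Icc]; omega
          · intro m _ _
            have := (abs_le.1 (ch_abs_le (p ^ m))).1
            apply mul_nonneg (by linarith) (by positivity)
  · obtain ⟨a, b, hab⟩ := Nat.Prime.sq_add_sq h3
    have hn : Zsqrtd.norm (⟨a, b⟩ : GaussianInt) = p := by
      rw [Zsqrtd.norm_def, ← hab]; push_cast; ring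
    have hprod : (p : GaussianInt) = (⟨a, b⟩ : GaussianInt) * star ⟨a, b⟩ := by
      rw [← Zsqrtd.norm_eq_mul_conj, hn]; simp
    set π : GaussianInt := ⟨a, b⟩ with hπ
    have hns : Zsqrtd.norm (star π) = p := by rw [Zsqrtd.norm_conj, hn]
    have hpr := prime_of_norm π p hp hn
    have step : ∀ e', π ^ e' ∣ P * star P → e' ≤ 2 * ∑ k ∈ Finset.Icc 1 T.card, T.card / p ^ k := by
      intro e' h'
      obtain ⟨i, j, hij, hi, hj⟩ := split_pow _ _ _ hpr e' h'
      have hj' := star_dvd_of _ _ hj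
      rw [star_pow] at hj'
      have b1 := vbound_split π p hp hn T P hP i hi
      have b2 := vbound_split (star π) p hp hns T P hP j hj'
      omega
    by_cases h1 : p % 4 = 1
    · have b := step e ((pow_dvd_pow_of_dvd (Dvd.intro _ hprod.symm) e).trans hd)
      have hch : ch p = 1 := by rw [ch_nat, h1]; norm_num
      have b' : (e : ℝ) ≤ 2 * ∑ k ∈ Finset.Icc 1 T.card, ((T.card / p ^ k : ℕ) : ℝ) := by exact_mod_cast b
      refine b'.trans (le_of_eq ?_)
      rw [Finset.mul_sum]
      apply Finset.sum_congr rfl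
      intro k _
      rw [ch_pow, hch]; norm_num
    · have hp2 : p = 2 := by
        rcases hp.eq_two_or_odd with h | h
        · exact h
        · omega
      have hch : ch p = 0 := by rw [ch_nat]; simp [h1, h3]
      have hdd : π ^ 2 ∣ (p : GaussianInt) := by
        rw [hp2] at hab
        have ha : a = 1 := by
          have : a ≤ 1 := by nlinarith
          interval_cases a
          · have : b ≤ 1 := by nlinarith
            interval_cases b <;> omega
          · rfl
        have hb : b = 1 := by
          rw [ha] at hab
          have : b ≤ 1 := by nlinarith
          interval_cases b <;> omega
        refine ⟨⟨0, -1⟩, ?_⟩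
        rw [hp2, hπ, ha, hb, Zsqrtd.ext_iff]
        constructor <;> simp [sq]
      have b := step (2 * e) (by rw [pow_mul]; exact (pow_dvd_pow_of_dvd hdd e).trans hd)
      have b' : (e : ℝ) ≤ ∑ k ∈ Finset.Icc 1 T.card, ((T.card / p ^ k : ℕ) : ℝ) := by
        have : e ≤ ∑ k ∈ Finset.Icc 1 T.card, T.card / p ^ k := by omega
        exact_mod_cast this
      refine b'.trans (le_of_eq ?_)
      apply Finset.sum_congr rfl
      intro k hk
      rw [ch_pow, hch, zero_pow (by have := (Finset.mem_Icc.1 hk).1; omega)]; norm_num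

lemma normP_log_le (T : Finset GaussianInt) (P : GaussianInt) (hP0 : P ≠ 0) (hP : ∀ z, P ∣ ∏ t ∈ T, (z - t)) :
    Real.log ((Zsqrtd.norm P : ℤ) : ℝ) ≤ Real.log T.card.factorial + ∑ m ∈ Finset.Ioc 0 T.card, cL m * ((T.card / m : ℕ) : ℝ) := by
  have h := logM_le (Zsqrtd.norm P).natAbs T.card (by rw [Int.natAbs_ne_zero]; exact fun h => hP0 (GaussianInt.norm_eq_zero.1 h)) (fact_bound T P hP)
  rwa [GaussianInt.natCast_natAbs_norm] at h
end

section
open Polynomial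

lemma lagrange_dvd (n : ℕ) (C : Finset GaussianInt) (hC : C.card = n + 1)
    (hU : IsNUniversal n C) (s : GaussianInt) (hs : s ∈ C) (z : GaussianInt) :
    ∏ t ∈ C.erase s, (s - t) ∣ ∏ t ∈ C.erase s, (z - t) := by
  have hinj : Function.Injective ι := IsFractionRing.injective GaussianInt FF
  have hP0 : ∏ t ∈ C.erase s, (s - t) ≠ 0 := by
    rw [Finset.prod_ne_zero_iff]
    intro t ht h
    exact (Finset.mem_erase.1 ht).1 (sub_eq_zero.1 h).symm
  set P := ∏ t ∈ C.erase s, (s - t) with hP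
  have hιP : ι P ≠ 0 := by rw [Ne, map_eq_zero_iff ι hinj]; exact hP0
  set f : FF[X] := Polynomial.C (ι P)⁻¹ * ∏ t ∈ C.erase s, (X - Polynomial.C (ι t)) with hf
  have hev : ∀ y : GaussianInt, f.eval (ι y) = (ι P)⁻¹ * ι (∏ t ∈ C.erase s, (y - t)) := by
    intro y
    rw [hf, eval_mul, eval_C, eval_prod]
    congr 1
    rw [map_prod]
    apply Finset.prod_congr rfl
    intro t _
    simp
  have hdeg : f.natDegree ≤ n := by
    refine (natDegree_C_mul_le _ _).trans ?_
    rw [natDegree_finsetProd_X_sub_C_eq_card, Finset.card_erase_of_mem hs, hC]; simp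
  obtain ⟨w, hw⟩ := hU f hdeg (by
    intro c hc
    rw [hev]
    by_cases hcs : c = s
    · subst hcs
      exact ⟨1, by rw [map_one, ← hP, inv_mul_cancel₀ hιP]⟩
    · refine ⟨0, ?_⟩
      rw [Finset.prod_eq_zero (Finset.mem_erase.2 ⟨hcs, hc⟩) (sub_self c)]
      simp) z
  rw [hev] at hw
  refine ⟨w, hinj ?_⟩
  rw [map_mul, hw, mul_inv_cancel_left₀ hιP]
end

section
open Filter Topology MeasureTheory Set

lemma maxp_aux {α : Type*} (S : Finset α) (x : α → ℂ) (s0 : α) (hs0 : s0 ∈ S) (Φ : ℝ)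
    (hΦ : ∀ w : ℂ, (∀ s ∈ S, 1 / 2 ≤ ‖w - x s‖) → ‖∑ s ∈ S, 1 / (w - x s)‖ ≤ Φ) :
    ∃ w : ℂ, ∃ s ∈ S, ‖w - x s‖ = 1 / 2 ∧ (S.card : ℝ) ^ S.card ≤ Φ ^ S.card * ∏ t ∈ S, ‖w - x t‖ := by
  set d : α → ℂ := fun s => x s - x s0 with hd
  set U : Set ℂ := {u | ∀ s ∈ S, ‖u‖ / 2 < ‖1 - u * d s‖} with hU
  set h : ℂ → ℂ := fun u => (∑ s ∈ S, 1 / (1 - u * d s)) ^ S.card * ∏ s ∈ S, (1 - u * d s) with hh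
  have hUo : IsOpen U := by
    have : U = ⋂ s ∈ S, {u | ‖u‖ / 2 < ‖1 - u * d s‖} := by ext u; simp [hU]
    rw [this]
    exact isOpen_biInter_finset fun s _ => isOpen_lt (by fun_prop) (by fun_prop)
  have h0U : (0 : ℂ) ∈ U := by intro s _; simp
  have hcl : ∀ u ∈ closure U, ∀ s ∈ S, ‖u‖ / 2 ≤ ‖1 - u * d s‖ := by
    intro u hu s hs
    have : closure U ⊆ {u | ‖u‖ / 2 ≤ ‖1 - u * d s‖} :=
      closure_minimal (fun v hv => (hv s hs).le) (isClosed_le (by fun_prop) (by fun_prop))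
    exact this hu
  have hne : ∀ u ∈ closure U, ∀ s ∈ S, 1 - u * d s ≠ 0 := by
    intro u hu s hs h0
    have h1 := hcl u hu s hs
    rw [h0, norm_zero] at h1
    have h2 : u = 0 := by
      rw [← norm_eq_zero]; linarith [norm_nonneg u]
    rw [h2] at h0
    simp at h0
  have hb : Bornology.IsBounded U := by
    apply (Metric.isBounded_ball (x := (0:ℂ)) (r := 2)).subset
    intro u hu
    have := hu s0 hs0
    simp only [hd, sub_self, mul_zero, sub_zero, norm_one] at this
    rw [mem_ball_zero_iff]; linarith
  have hdiff : DiffContOnCl ℂ h U := by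
    apply DifferentiableOn.diffContOnCl
    intro u hu
    apply DifferentiableAt.differentiableWithinAt
    have e1 : DifferentiableAt ℂ (fun u => ∑ s ∈ S, 1 / (1 - u * d s)) u := by
      apply DifferentiableAt.fun_sum
      intro s hs
      exact DifferentiableAt.fun_div (by fun_prop) (by fun_prop) (hne u hu s hs)
    have e2 : DifferentiableAt ℂ (fun u => ∏ s ∈ S, (1 - u * d s)) u := by
      apply DifferentiableAt.fun_finsetProd
      intro s hs
      fun_prop
    exact (e1.fun_pow _).fun_mul e2
  obtain ⟨u, hu, hmax⟩ := Complex.exists_mem_frontier_isMaxOn_norm hb ⟨0, h0U⟩ hdiff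
  have h1 : ‖h 0‖ ≤ ‖h u‖ := hmax (subset_closure h0U)
  have h2 : ‖h 0‖ = (S.card : ℝ) ^ S.card := by simp [hh]
  rw [frontier, hUo.interior_eq] at hu
  have hu0 : u ≠ 0 := fun h => hu.2 (h ▸ h0U)
  have hnu : 0 < ‖u‖ := norm_pos_iff.2 hu0
  have hws : ∀ s, (x s0 + 1 / u) - x s = (1 / u) * (1 - u * d s) := by
    intro s; simp only [hd]; field_simp; ring
  have hw2 : ∀ s ∈ S, 1 / 2 ≤ ‖(x s0 + 1 / u) - x s‖ := by
    intro s hs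
    rw [hws, norm_mul, norm_div, norm_one, div_mul_eq_mul_div, le_div_iff₀ hnu]
    linarith [hcl u hu.1 s hs]
  have h3 := hu.2
  simp only [hU, Set.mem_setOf_eq, not_forall, not_lt] at h3
  obtain ⟨s, hs, h3⟩ := h3
  refine ⟨x s0 + 1 / u, s, hs, le_antisymm ?_ (hw2 s hs), ?_⟩
  · rw [hws, norm_mul, norm_div, norm_one, div_mul_eq_mul_div, div_le_iff₀ hnu]
    linarith
  rw [← h2]
  refine h1.trans ?_
  have h4 : h u = (∑ s ∈ S, 1 / ((x s0 + 1 / u) - x s)) ^ S.card * ∏ s ∈ S, ((x s0 + 1 / u) - x s) := by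
    simp only [hws, hh]
    rw [Finset.prod_mul_distrib, Finset.prod_const, ← mul_assoc, ← mul_pow, Finset.sum_mul]
    congr 2
    apply Finset.sum_congr rfl
    intro s hs
    have := hne u hu.1 s hs
    field_simp
  rw [h4, norm_mul, norm_pow, norm_prod]
  gcongr
  exact hΦ _ hw2
end

section
open Filter Topology MeasureTheory Set

lemma gnorm_ge_one (a b : GaussianInt) (h : a ≠ b) : 1 ≤ ‖(a : ℂ) - b‖ := by
  have h1 : 1 ≤ Zsqrtd.norm (a - b) := Int.add_one_le_iff.2 (GaussianInt.norm_pos.2 (sub_ne_zero.2 h))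
  have h2 : (1 : ℝ) ≤ (Zsqrtd.norm (a - b) : ℝ) := by exact_mod_cast h1
  rw [GaussianInt.intCast_real_norm, Complex.normSq_eq_norm_sq, GaussianInt.toComplex_sub] at h2
  nlinarith [norm_nonneg ((a : ℂ) - b)]

lemma prod_near (S : Finset GaussianInt) (s : GaussianInt) (hs : s ∈ S) (w : ℂ) (hw : ‖w - s‖ = 1 / 2) :
    ∏ t ∈ S, ‖w - (t : ℂ)‖ ≤ ‖∏ t ∈ S.erase s, ((s : ℂ) - t)‖ * Real.exp ((∑ t ∈ S.erase s, 1 / ‖(s : ℂ) - t‖) / 2) := by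
  rw [← Finset.mul_prod_erase S _ hs, hw, norm_prod, Finset.sum_div, Real.exp_sum, ← Finset.prod_mul_distrib]
  have h1 : ∏ t ∈ S.erase s, ‖w - (t : ℂ)‖ ≤ ∏ t ∈ S.erase s, ‖(s : ℂ) - t‖ * Real.exp (1 / ‖(s : ℂ) - t‖ / 2) := by
    apply Finset.prod_le_prod (fun _ _ => norm_nonneg _)
    intro t ht
    have hd := gnorm_ge_one s t (Finset.mem_erase.1 ht).1.symm
    have h2 : ‖w - (t : ℂ)‖ ≤ ‖w - s‖ + ‖(s : ℂ) - t‖ := by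
      have := norm_add_le (w - (s : ℂ)) ((s : ℂ) - t)
      simpa using this
    have h3 := Real.add_one_le_exp (1 / ‖(s : ℂ) - t‖ / 2)
    calc ‖w - (t : ℂ)‖ ≤ ‖(s : ℂ) - t‖ * (1 / ‖(s : ℂ) - t‖ / 2 + 1) := by
          rw [hw] at h2
          have : ‖(s : ℂ) - t‖ * (1 / ‖(s : ℂ) - t‖ / 2 + 1) = 1 / 2 + ‖(s : ℂ) - t‖ := by
            field_simp
          linarith
      _ ≤ _ := by gcongr
  have h0 : 0 ≤ ∏ t ∈ S.erase s, ‖w - (t : ℂ)‖ := Finset.prod_nonneg fun _ _ => norm_nonneg _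
  linarith

lemma sum_inv_dist (S : Finset GaussianInt) (s : GaussianInt) (K : ℕ) (hK : 1 ≤ K) :
    ∑ t ∈ S.erase s, 1 / ‖(s : ℂ) - t‖ ≤ (2 * K + 1) ^ 2 + (S.card : ℝ) / K := by
  classical
  have hK' : (0:ℝ) < K := by exact_mod_cast hK
  rw [← Finset.sum_filter_add_sum_filter_not (S.erase s) (fun t : GaussianInt => ‖(s : ℂ) - t‖ ≤ K)]
  apply add_le_add
  · set A := (S.erase s).filter (fun t : GaussianInt => ‖(s : ℂ) - t‖ ≤ K) with hA
    have h1 : ∑ t ∈ A, 1 / ‖(s : ℂ) - t‖ ≤ A.card := by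
      calc _ ≤ ∑ t ∈ A, (1:ℝ) := by
            apply Finset.sum_le_sum
            intro t ht
            have := gnorm_ge_one s t (Finset.mem_erase.1 (Finset.mem_filter.1 ht).1).1.symm
            rw [div_le_one (by linarith)]; exact this
        _ = _ := by simp
    have h2 : A.card ≤ (2 * K + 1) ^ 2 := by
      calc A.card ≤ (Finset.Icc (-K : ℤ) K ×ˢ Finset.Icc (-K : ℤ) K).card := by
            apply Finset.card_le_card_of_injOn (fun t => ((s - t).re, (s - t).im))
            · intro t ht
              have h3 := (Finset.mem_filter.1 ht).2
              rw [← GaussianInt.toComplex_sub] at h3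
              have h4 := (Complex.abs_re_le_norm _).trans h3
              have h5 := (Complex.abs_im_le_norm _).trans h3
              rw [← GaussianInt.intCast_re] at h4
              rw [← GaussianInt.intCast_im] at h5
              have h4' : |(s - t).re| ≤ (K : ℤ) := by exact_mod_cast h4
              have h5' : |(s - t).im| ≤ (K : ℤ) := by exact_mod_cast h5
              rw [abs_le] at h4' h5'
              simp only [Finset.coe_product, Set.mem_prod, Finset.coe_Icc, Set.mem_Icc]
              exact ⟨h4', h5'⟩
            · intro t _ t' _ h
              simp only [Prod.mk.injEq, Zsqrtd.re_sub, Zsqrtd.im_sub, sub_right_inj] at h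
              exact Zsqrtd.ext h.1 h.2
        _ = (2 * K + 1) ^ 2 := by
            rw [Finset.card_product, Int.card_Icc, sq]
            congr 1 <;> omega
    exact h1.trans (by exact_mod_cast h2)
  · set B := (S.erase s).filter (fun t : GaussianInt => ¬ ‖(s : ℂ) - t‖ ≤ K) with hB
    calc ∑ t ∈ B, 1 / ‖(s : ℂ) - t‖ ≤ ∑ t ∈ B, 1 / (K : ℝ) := by
          apply Finset.sum_le_sum
          intro t ht
          have := (Finset.mem_filter.1 ht).2
          apply one_div_le_one_div_of_le hK' (not_le.1 this).le
      _ = B.card * (1 / (K:ℝ)) := by simp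
      _ ≤ _ := by
          rw [mul_one_div]
          gcongr
          exact (Finset.filter_subset _ _).trans (Finset.erase_subset _ _)

lemma lattice_count (A : Finset GaussianInt) (c : ℂ) (R : ℝ) (hR : 0 ≤ R) (hA : ∀ t ∈ A, ‖(t : ℂ) - c‖ < R) :
    (A.card : ℝ) ≤ Real.pi * (R + 2) ^ 2 := by
  set Q : GaussianInt → Set ℂ := fun t => (Ico (t.re : ℝ) (t.re + 1)) ×ℂ (Ico (t.im : ℝ) (t.im + 1)) with hQ
  have h1 : ∀ t, Q t = Complex.measurableEquivRealProd ⁻¹' ((Ico (t.re : ℝ) (t.re + 1)) ×ˢ (Ico (t.im : ℝ) (t.im + 1))) := by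
    intro t
    ext z; simp [hQ, Complex.mem_reProdIm, Complex.measurableEquivRealProd_apply]
  have hm : ∀ t, MeasurableSet (Q t) := fun t => by
    rw [h1]
    exact Complex.measurableEquivRealProd.measurable (measurableSet_Ico.prod measurableSet_Ico)
  have hv : ∀ t, volume (Q t) = 1 := by
    intro t
    rw [h1, Complex.volume_preserving_equiv_real_prod.measure_preimage (measurableSet_Ico.prod measurableSet_Ico).nullMeasurableSet,
      Measure.volume_eq_prod, Measure.prod_prod, Real.volume_Ico, Real.volume_Ico]
    simp
  have hdisj : Set.PairwiseDisjoint (A : Set GaussianInt) Q := by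
    intro a _ b _ hab
    rw [Function.onFun, Set.disjoint_left]
    intro z ha hb
    simp only [hQ, Complex.mem_reProdIm, Set.mem_Ico] at ha hb
    apply hab
    apply Zsqrtd.ext
    · have e1 := Int.floor_eq_iff.2 ha.1
      have e2 := Int.floor_eq_iff.2 hb.1
      exact e1.symm.trans e2
    · have e1 := Int.floor_eq_iff.2 ha.2
      have e2 := Int.floor_eq_iff.2 hb.2
      exact e1.symm.trans e2
  have hsub : (⋃ t ∈ A, Q t) ⊆ Metric.ball c (R + 2) := by
    intro z hz
    simp only [Set.mem_iUnion] at hz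
    obtain ⟨t, ht, hz⟩ := hz
    simp only [hQ, Complex.mem_reProdIm, Set.mem_Ico] at hz
    rw [mem_ball_iff_norm]
    have h1 : ‖z - c‖ ≤ ‖z - t‖ + ‖(t : ℂ) - c‖ := by
      have := norm_add_le (z - (t : ℂ)) ((t : ℂ) - c)
      simpa using this
    have h2 : ‖z - t‖ ≤ |(z - t).re| + |(z - t).im| := Complex.norm_le_abs_re_add_abs_im _
    have h3 : |(z - t).re| ≤ 1 := by
      rw [Complex.sub_re, ← GaussianInt.intCast_re, abs_le]; constructor <;> linarith [hz.1.1, hz.1.2]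
    have h4 : |(z - t).im| ≤ 1 := by
      rw [Complex.sub_im, ← GaussianInt.intCast_im, abs_le]; constructor <;> linarith [hz.2.1, hz.2.2]
    linarith [hA t ht]
  have h1 := measure_mono (μ := volume) hsub
  rw [measure_biUnion_finset hdisj (fun t _ => hm t), Complex.volume_ball] at h1
  simp only [hv, Finset.sum_const, nsmul_eq_mul, mul_one] at h1
  have h2 := ENNReal.toReal_mono (by finiteness) h1
  rw [ENNReal.toReal_mul, ENNReal.toReal_pow, ENNReal.toReal_ofReal (by linarith)] at h2
  simp only [ENNReal.toReal_natCast, ENNReal.coe_toReal, NNReal.coe_real_pi] at h2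
  linarith
end

section
open Filter Topology MeasureTheory Set

lemma disc_sum {α : Type*} [DecidableEq α] (S : Finset α) (φ : α → ℝ) (a : ℕ → ℝ)
    (h : ∀ k < S.card, (S.filter (fun s => a k < φ s)).card ≤ k) : ∑ s ∈ S, φ s ≤ ∑ k ∈ Finset.range S.card, a k := by
  induction hN : S.card generalizing S with
  | zero => rw [Finset.card_eq_zero] at hN; simp [hN]
  | succ N ih =>
    obtain ⟨s, hs, hmin⟩ := Finset.exists_min_image S φ (Finset.card_pos.1 (by omega))
    have hle : φ s ≤ a N := by
      by_contra hlt
      have h1 := h N (by omega)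
      have h2 : S.filter (fun s => a N < φ s) = S := by
        rw [Finset.filter_eq_self]
        intro t ht
        exact (not_le.1 hlt).trans_le (hmin t ht)
      rw [h2] at h1; omega
    have hc : (S.erase s).card = N := by rw [Finset.card_erase_of_mem hs]; omega
    rw [← Finset.add_sum_erase S φ hs, Finset.sum_range_succ, add_comm]
    refine add_le_add (ih (S.erase s) ?_ hc) hle
    intro k hk
    exact (Finset.card_le_card (Finset.filter_subset_filter _ (Finset.erase_subset _ _))).trans (h k (by omega))

lemma sqrt_step (k : ℕ) (hk : 1 ≤ k) : 1 / (2 * Real.sqrt k) ≤ Real.sqrt k - Real.sqrt (k - 1 : ℕ) := by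
  have hk0 : (0:ℝ) < k := by exact_mod_cast hk
  have h1 : ((k - 1 : ℕ) : ℝ) = k - 1 := by push_cast [hk]; ring
  have h2 := Real.sq_sqrt hk0.le
  have h3 : Real.sqrt (k - 1 : ℕ) ^ 2 = k - 1 := by rw [Real.sq_sqrt (by positivity), h1]
  have hp := Real.sqrt_pos.2 hk0
  rw [div_le_iff₀ (by positivity)]
  nlinarith [sq_nonneg (Real.sqrt k - Real.sqrt (k - 1 : ℕ))]

lemma sum_a_le (K1 : ℕ) (hK : 1 ≤ K1) (c : ℝ) (hc : 0 ≤ c) (N : ℕ) :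
    ∑ k ∈ Finset.range N, (if k < K1 then (2:ℝ) else c * (1 / (2 * Real.sqrt k))) ≤ 2 * (min N K1 : ℕ) + c * Real.sqrt (N - 1 : ℕ) := by
  induction N with
  | zero => simp
  | succ N ih =>
    rw [Finset.sum_range_succ]
    have hmono : Real.sqrt (N - 1 : ℕ) ≤ Real.sqrt N := Real.sqrt_le_sqrt (by exact_mod_cast Nat.sub_le N 1)
    have e : N + 1 - 1 = N := rfl
    rw [e]
    split_ifs with h
    · have h1 : min (N+1) K1 = min N K1 + 1 := by omega
      rw [h1, Nat.cast_add, Nat.cast_one]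
      nlinarith
    · have h1 : min (N+1) K1 = min N K1 := by omega
      rw [h1]
      have := sqrt_step N (by omega)
      nlinarith

lemma phi_count (S : Finset GaussianInt) (w c : ℂ) (hc : ‖c‖ = 1) (hw : ∀ s ∈ S, 1 / 2 ≤ ‖w - s‖) (μ : ℝ) (hμ : 0 < μ) :
    ((S.filter (fun s : GaussianInt => μ < (c / (w - s)).re)).card : ℝ) ≤ Real.pi * (1 / (2 * μ) + 2) ^ 2 := by
  apply lattice_count _ (w - c / (2 * μ)) _ (by positivity)
  intro t ht
  obtain ⟨h1, h2⟩ := Finset.mem_filter.1 ht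
  have hv := hw t h1
  set v := w - (t : ℂ) with hv'
  have e1 : (t : ℂ) - (w - c / (2 * μ)) = -(v - c / (2 * μ)) := by rw [hv']; ring
  rw [e1, norm_neg]
  have hv0 : 0 < Complex.normSq v := by
    rw [Complex.normSq_eq_norm_sq]; nlinarith
  rw [Complex.div_re, ← add_div, lt_div_iff₀ hv0] at h2
  have hc2 : Complex.normSq c = 1 := by rw [Complex.normSq_eq_norm_sq, hc]; norm_num
  have h3 : ‖v - c / (2 * μ)‖ ^ 2 < (1 / (2 * μ)) ^ 2 := by
    have e2 : c / (2 * μ) = ((1 / (2 * μ) : ℝ) : ℂ) * c := by push_cast; ring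
    rw [e2, ← Complex.normSq_eq_norm_sq]
    set r := 1 / (2 * μ) with hr
    have hrμ : r * (2 * μ) = 1 := by rw [hr]; field_simp
    have hr0 : 0 < r := by positivity
    rw [Complex.normSq_apply] at hc2 h2 ⊢
    simp only [Complex.sub_re, Complex.sub_im, Complex.re_ofReal_mul, Complex.im_ofReal_mul]
    have h5 := mul_lt_mul_of_pos_left h2 (by positivity : 0 < 2 * r)
    have h6 : 2 * r * (μ * (v.re * v.re + v.im * v.im)) = v.re * v.re + v.im * v.im := by
      linear_combination (v.re * v.re + v.im * v.im) * hrμ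
    rw [h6] at h5
    have h7 : (r * c.re) * (r * c.re) + (r * c.im) * (r * c.im) = r ^ 2 := by linear_combination r ^ 2 * hc2
    nlinarith
  exact lt_of_pow_lt_pow_left₀ 2 (by positivity) h3

lemma phi_bound (δ : ℝ) (hδ : 0 < δ) (hδ1 : δ < 1) : ∃ B : ℝ, 0 ≤ B ∧ ∀ (S : Finset GaussianInt) (w : ℂ),
    (∀ s ∈ S, 1 / 2 ≤ ‖w - s‖) → ‖∑ s ∈ S, 1 / (w - (s : ℂ))‖ ≤ B + Real.sqrt Real.pi / (1 - δ) * Real.sqrt S.card := by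
  classical
  have hd1 : 0 < 1 - δ := by linarith
  obtain ⟨K0, hK0⟩ := exists_nat_gt (Real.pi * (2 / δ) ^ 2)
  set K1 := K0 + 1 with hK1
  refine ⟨2 * K1, by positivity, fun S w hw => ?_⟩
  set Z := ∑ s ∈ S, 1 / (w - (s : ℂ)) with hZ
  by_cases hZ0 : Z = 0
  · rw [hZ0, norm_zero]; positivity
  have hZn : 0 < ‖Z‖ := norm_pos_iff.2 hZ0
  set c : ℂ := (starRingEnd ℂ) Z / ‖Z‖ with hc
  have hcn : ‖c‖ = 1 := by rw [hc, norm_div]; simp [hZ0]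
  have hcZ : c * Z = (‖Z‖ : ℂ) := by
    rw [hc, div_mul_eq_mul_div, mul_comm, Complex.mul_conj, Complex.normSq_eq_norm_sq]
    push_cast
    have : (‖Z‖ : ℂ) ≠ 0 := by exact_mod_cast hZn.ne'
    field_simp
  have h1 : ‖Z‖ = ∑ s ∈ S, (c / (w - (s : ℂ))).re := by
    have := congrArg Complex.re hcZ
    rw [Complex.ofReal_re, hZ, Finset.mul_sum, Complex.re_sum] at this
    rw [← this]
    apply Finset.sum_congr rfl
    intro s _
    rw [mul_one_div]
  rw [h1]
  set C := Real.sqrt Real.pi / (1 - δ) with hC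
  have hC0 : 0 < C := div_pos (Real.sqrt_pos.2 Real.pi_pos) hd1
  have h2 := disc_sum S (fun s : GaussianInt => (c / (w - (s : ℂ))).re) (fun k => if k < K1 then (2:ℝ) else C * (1 / (2 * Real.sqrt k))) ?_
  · refine h2.trans ((sum_a_le K1 (by omega) C hC0.le S.card).trans ?_)
    have e1 : ((min S.card K1 : ℕ) : ℝ) ≤ K1 := by exact_mod_cast min_le_right _ _
    have e2 : Real.sqrt (S.card - 1 : ℕ) ≤ Real.sqrt S.card := Real.sqrt_le_sqrt (by exact_mod_cast Nat.sub_le _ 1)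
    gcongr
  · intro k hk
    split_ifs with hkK
    · rw [Finset.card_eq_zero.2 _]
      · exact Nat.zero_le _
      rw [Finset.filter_eq_empty_iff]
      intro s hs
      rw [not_lt]
      refine (Complex.re_le_norm _).trans ?_
      rw [norm_div, hcn, div_le_iff₀ (by linarith [hw s hs])]
      linarith [hw s hs]
    · have hk0 : (0:ℝ) < k := by
        have : 0 < k := by omega
        exact_mod_cast this
      have hkK0 : (K0 : ℝ) ≤ k := by
        have : K0 ≤ k := by omega
        exact_mod_cast this
      have hsk := Real.sqrt_pos.2 hk0
      have hsp := Real.sqrt_pos.2 Real.pi_pos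
      have h3 := phi_count S w c hcn hw (C * (1 / (2 * Real.sqrt k))) (by positivity)
      have h4 : 1 / (2 * (C * (1 / (2 * Real.sqrt k)))) = (1 - δ) * (Real.sqrt k / Real.sqrt Real.pi) := by
        rw [hC]; field_simp
      rw [h4] at h3
      have h5 : 2 ≤ δ * (Real.sqrt k / Real.sqrt Real.pi) := by
        have h6 : Real.sqrt Real.pi * (2 / δ) ≤ Real.sqrt k := by
          apply Real.le_sqrt_of_sq_le
          rw [mul_pow, Real.sq_sqrt Real.pi_pos.le]; linarith
        rw [mul_div_assoc', le_div_iff₀ hsp]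
        rw [mul_div_assoc', div_le_iff₀ hδ] at h6
        linarith
      have h7 : Real.pi * ((1 - δ) * (Real.sqrt k / Real.sqrt Real.pi) + 2) ^ 2 ≤ k := by
        have h8 : ((1 - δ) * (Real.sqrt k / Real.sqrt Real.pi) + 2) ^ 2 ≤ (Real.sqrt k / Real.sqrt Real.pi) ^ 2 := by
          apply pow_le_pow_left₀ (by positivity)
          linarith
        rw [div_pow, Real.sq_sqrt hk0.le, Real.sq_sqrt Real.pi_pos.le, le_div_iff₀ Real.pi_pos] at h8
        linarith
      exact_mod_cast h3.trans h7
end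

section
open Filter Topology MeasureTheory Set

lemma lower_bound (η : ℝ) (hη : 0 < η) : ∃ N0 : ℕ, ∀ S : Finset GaussianInt, N0 ≤ S.card → ∃ s ∈ S,
    (S.card : ℝ) * Real.log S.card - S.card * Real.log Real.pi - 4 * η * S.card ≤
      Real.log ((Zsqrtd.norm (∏ t ∈ S.erase s, (s - t)) : ℤ) : ℝ) := by
  have hsp := Real.sqrt_pos.2 Real.pi_pos
  have hE : Real.exp (-(η/2)) < 1 := Real.exp_lt_one_iff.2 (by linarith)
  obtain ⟨B, hB0, hB⟩ := phi_bound (1 - Real.exp (-(η/2))) (by linarith) (by linarith [Real.exp_pos (-(η/2))])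
  obtain ⟨K, hK⟩ := exists_nat_gt (1 / η)
  have hK0 : (0:ℝ) < K := lt_trans (by positivity) hK
  have hKn : 1 ≤ K := by exact_mod_cast hK0
  set G := Real.sqrt Real.pi * (Real.exp η - Real.exp (η/2)) with hG
  have hG0 : 0 < G := mul_pos hsp (sub_pos.2 (Real.exp_lt_exp.2 (by linarith)))
  obtain ⟨N1, hN1⟩ := exists_nat_gt ((B / G) ^ 2)
  obtain ⟨N2, hN2⟩ := exists_nat_gt ((2 * K + 1) ^ 2 / η)
  refine ⟨N1 + N2 + 1, fun S hS => ?_⟩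
  have hNpos : 0 < S.card := by omega
  set N := S.card with hN
  have hNr : (0:ℝ) < N := by exact_mod_cast hNpos
  have hsN := Real.sqrt_pos.2 hNr
  have hN1' : (N1:ℝ) ≤ N := by exact_mod_cast (by omega : N1 ≤ N)
  have hN2' : (N2:ℝ) ≤ N := by exact_mod_cast (by omega : N2 ≤ N)
  obtain ⟨s0, hs0⟩ := Finset.card_pos.1 hNpos
  set Φ := Real.sqrt Real.pi * Real.exp η * Real.sqrt N with hΦd
  have hΦ0 : 0 < Φ := by positivity
  have hΦ : ∀ w : ℂ, (∀ s ∈ S, 1 / 2 ≤ ‖w - (s : ℂ)‖) → ‖∑ s ∈ S, 1 / (w - (s : ℂ))‖ ≤ Φ := by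
    intro w hw
    refine (hB S w hw).trans ?_
    have e1 : B ≤ G * Real.sqrt N := by
      have : B / G ≤ Real.sqrt N := Real.le_sqrt_of_sq_le (by linarith)
      rw [div_le_iff₀ hG0] at this; linarith
    have e2 : Real.sqrt Real.pi / (1 - (1 - Real.exp (-(η/2)))) = Real.sqrt Real.pi * Real.exp (η/2) := by
      rw [sub_sub_cancel, Real.exp_neg, div_inv_eq_mul]
    rw [e2]
    calc _ ≤ G * Real.sqrt N + Real.sqrt Real.pi * Real.exp (η/2) * Real.sqrt N := by gcongr
      _ = Φ := by rw [hG, hΦd]; ring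
  obtain ⟨w, s, hs, hws, hmain⟩ := maxp_aux S (fun s : GaussianInt => (s : ℂ)) s0 hs0 Φ hΦ
  refine ⟨s, hs, ?_⟩
  have hnear := prod_near S s hs w hws
  have hsum := sum_inv_dist S s K hKn
  set Q := ∑ t ∈ S.erase s, 1 / ‖(s : ℂ) - t‖ with hQ
  set P : ℂ := ∏ t ∈ S.erase s, ((s : ℂ) - t) with hP
  have hP0 : 0 < ‖P‖ := by
    rw [norm_pos_iff, hP, Finset.prod_ne_zero_iff]
    intro t ht h0
    have := gnorm_ge_one s t (Finset.mem_erase.1 ht).1.symm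
    rw [h0, norm_zero] at this
    linarith
  have hQ2 : Q ≤ 2 * η * N := by
    have e1 : ((2 * K + 1) ^ 2 : ℝ) ≤ η * N := by
      rw [div_lt_iff₀ hη] at hN2
      nlinarith
    have e2 : (N : ℝ) / K ≤ η * N := by
      rw [div_le_iff₀ hK0]
      rw [div_lt_iff₀ hη] at hK
      nlinarith
    linarith
  have hnorm : ((Zsqrtd.norm (∏ t ∈ S.erase s, (s - t)) : ℤ) : ℝ) = ‖P‖ ^ 2 := by
    rw [GaussianInt.intCast_real_norm, Complex.normSq_eq_norm_sq, map_prod, hP]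
    congr 3
    ext t
    rw [GaussianInt.toComplex_sub]
  rw [hnorm, Real.log_pow]
  have h1 : (N : ℝ) ^ N ≤ Φ ^ N * (‖P‖ * Real.exp (Q / 2)) := hmain.trans (by gcongr)
  have h2 := Real.log_le_log (by positivity) h1
  rw [Real.log_pow, Real.log_mul (by positivity) (by positivity), Real.log_mul (by positivity) (by positivity), Real.log_pow,
    Real.log_exp, hΦd, Real.log_mul (by positivity) (by positivity), Real.log_mul (by positivity) (by positivity), Real.log_exp,
    Real.log_sqrt Real.pi_pos.le, Real.log_sqrt hNr.le] at h2
  push_cast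
  nlinarith
end

lemma log_pi_lt : Real.log Real.pi ≤ 1.15 := by
  rw [Real.log_le_iff_le_exp Real.pi_pos]
  have h1 := Real.exp_one_gt_d9
  have h2 := Real.quadratic_le_exp_of_nonneg (x := (0.15:ℝ)) (by norm_num)
  have h3 : Real.exp 1.15 = Real.exp 1 * Real.exp 0.15 := by rw [← Real.exp_add]; norm_num
  rw [h3]
  have h4 := Real.pi_lt_d4
  have h5 : (1.16125:ℝ) ≤ Real.exp 0.15 := by norm_num at h2 ⊢; linarith
  nlinarith

theorem no_small_universal_sets :
    ∃ N : ℕ, ∀ n : ℕ, N ≤ n → ∀ C : Finset GaussianInt, C.card = n + 1 →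
      ∃ f : FF[X], f.natDegree ≤ n ∧ (∀ c ∈ C, f.eval (ι c) ∈ Set.range ι) ∧
        ∃ z : GaussianInt, f.eval (ι z) ∉ Set.range ι := by
  obtain ⟨N0, hN0⟩ := lower_bound (1/4000) (by norm_num)
  have hlog : ∀ᶠ n : ℕ in Filter.atTop, Real.log n ≤ 0.001 * n := by
    have h := (Real.isLittleO_log_id_atTop.bound (c := 0.001) (by norm_num)).natCast_atTop
    filter_upwards [h] with n hn
    have h2 := (le_abs_self _).trans hn
    simpa using h2
  obtain ⟨N1, hN1⟩ := Filter.eventually_atTop.1 (E_bound.and hlog)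
  refine ⟨N0 + N1 + 1000, fun n hn C hC => ?_⟩
  by_contra hcon
  have hU : IsNUniversal n C := by
    intro f hf hv z
    by_contra hz
    exact hcon ⟨f, hf, hv, z, hz⟩
  obtain ⟨s, hs, hlow⟩ := hN0 C (by omega)
  have hcard : (C.erase s).card = n := by rw [Finset.card_erase_of_mem hs, hC]; rfl
  have hP0 : ∏ t ∈ C.erase s, (s - t) ≠ 0 := by
    rw [Finset.prod_ne_zero_iff]
    intro t ht h
    exact (Finset.mem_erase.1 ht).1 (sub_eq_zero.1 h).symm
  have hup := normP_log_le (C.erase s) _ hP0 (lagrange_dvd n C hC hU s hs)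
  rw [hcard] at hup
  obtain ⟨hE, hl⟩ := hN1 n (by omega)
  have hf := log_fact_le n (by omega)
  rw [hC] at hlow
  push_cast at hlow
  have hn' : (1000:ℝ) ≤ n := by exact_mod_cast (by omega : 1000 ≤ n)
  have hpi := log_pi_lt
  have hm : Real.log n ≤ Real.log (n + 1) := Real.log_le_log (by linarith) (by linarith)
  have hl0 : 0 ≤ Real.log n := Real.log_nonneg (by linarith)
  have e1 : (n : ℝ) * Real.log n ≤ (n + 1) * Real.log (n + 1) := by nlinarith
  have e2 : ((n : ℝ) + 1) * Real.log Real.pi ≤ (n + 1) * 1.15 := by nlinarith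
  linarith
end

section
/- There exists an absolute constant K such that for every natural number n there exists an n-universal set in ℤ[i] of cardinality at most K·(n+1). -/
open Polynomial

noncomputable def gaussBasis : Module.Basis (Fin 2) ℤ GaussianInt :=
  Module.Basis.ofEquivFun
    { toFun := fun z => ![z.re, z.im]
      invFun := fun v => ⟨v 0, v 1⟩
      map_add' := by intro x y; ext i; fin_cases i <;> simp
      map_smul' := by intro x y; ext i; fin_cases i <;> simp
      left_inv := by intro x; simp
      right_inv := by intro v; ext i; fin_cases i <;> simp }

lemma gauss_card_quot (a : GaussianInt) :
    Nat.card (GaussianInt ⧸ Ideal.span {a}) = a.norm.natAbs := by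
  have : Module.Free ℤ GaussianInt := Module.Free.of_basis gaussBasis
  have : Module.Finite ℤ GaussianInt := Module.Finite.of_basis gaussBasis
  have h := Ideal.absNorm_span_singleton a
  rw [Ideal.absNorm_apply, Submodule.cardQuot_apply] at h
  rw [h, Algebra.norm_eq_matrix_det gaussBasis, Matrix.det_fin_two]
  simp [Algebra.leftMulMatrix_eq_repr_mul, gaussBasis, Zsqrtd.norm_def]

lemma gauss_norm_add_le (a b : GaussianInt) : (a + b).norm ≤ 2 * (a.norm + b.norm) := by
  simp only [Zsqrtd.norm_def, Zsqrtd.re_add, Zsqrtd.im_add]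
  nlinarith [sq_nonneg (a.re - b.re), sq_nonneg (a.im - b.im)]

/-- counting of the exponents `1 ≤ k ≤ K` with `p ^ k ∣ x` -/
noncomputable def vK (p : GaussianInt) (K : ℕ) (x : GaussianInt) : ℕ := by
  classical exact ((Finset.Icc 1 K).filter (fun k => p ^ k ∣ x)).card

lemma vK_dvd (p : GaussianInt) (K : ℕ) (x : GaussianInt) : p ^ vK p K x ∣ x := by
  classical
  by_contra h
  have : (Finset.Icc 1 K).filter (fun k => p ^ k ∣ x) ⊆ Finset.Ico 1 (vK p K x) := by
    intro k hk
    simp only [Finset.mem_filter, Finset.mem_Icc, Finset.mem_Ico] at hk ⊢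
    refine ⟨hk.1.1, ?_⟩
    by_contra hlt
    exact h ((pow_dvd_pow p (not_lt.1 hlt)).trans hk.2)
  have h2 := Finset.card_le_card this
  have h3 : vK p K x ≤ vK p K x - 1 := by simpa [vK] using h2
  have h4 : vK p K x = 0 := by omega
  rw [h4] at h
  simp at h

lemma vK_not_dvd (p : GaussianInt) (K : ℕ) (x : GaussianInt) (h : ¬ p ^ (K + 1) ∣ x) :
    ¬ p ^ (vK p K x + 1) ∣ x := by
  classical
  intro h1
  have hle : vK p K x + 1 ≤ K := by
    by_contra hc
    exact h ((pow_dvd_pow p (by omega)).trans h1)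
  have : Finset.Icc 1 (vK p K x + 1) ⊆ (Finset.Icc 1 K).filter (fun k => p ^ k ∣ x) := by
    intro k hk
    simp only [Finset.mem_filter, Finset.mem_Icc] at hk ⊢
    exact ⟨⟨hk.1, hk.2.trans hle⟩, (pow_dvd_pow p hk.2).trans h1⟩
  have h2 := Finset.card_le_card this
  have h3 : vK p K x + 1 ≤ vK p K x := by simpa [vK] using h2
  omega

lemma exists_W (p : GaussianInt) (hp : Prime p) (d : ℕ) (hd0 : 0 < d) (hd : (d : ℤ) ≤ p.norm) :
    ∃ W : Finset GaussianInt, W.card = d ∧ (∀ w ∈ W, w.norm ≤ 2 * d) ∧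
      ∀ w ∈ W, ∀ w' ∈ W, p ∣ w - w' → w = w' := by
  classical
  by_cases hc : (2 * d : ℤ) ≤ p.norm
  · -- small box
    set m := Nat.sqrt (d - 1) with hm
    have h1 : m * m ≤ d - 1 := Nat.sqrt_le _
    have h2 : d - 1 < (m + 1) * (m + 1) := Nat.lt_succ_sqrt _
    let B : Finset GaussianInt := (Finset.range (m+1) ×ˢ Finset.range (m+1)).image
      (fun x => (⟨(x.1 : ℤ), (x.2 : ℤ)⟩ : GaussianInt))
    have hB : d ≤ B.card := by
      rw [Finset.card_image_of_injective]
      · simp; omega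
      · rintro ⟨a, b⟩ ⟨c, e⟩ h
        simpa [Zsqrtd.ext_iff] using h
    obtain ⟨W, hWB, hW⟩ := Finset.exists_subset_card_eq hB
    have hmem : ∀ w ∈ W, 0 ≤ w.re ∧ w.re ≤ m ∧ 0 ≤ w.im ∧ w.im ≤ m := by
      intro w hw
      have := hWB hw
      simp only [B, Finset.mem_image, Finset.mem_product, Finset.mem_range] at this
      obtain ⟨⟨a, b⟩, ⟨ha, hb⟩, rfl⟩ := this
      simp only at ha hb ⊢
      omega
    have hmd : (m * m : ℤ) < d := by
      have : m * m < d := by omega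
      exact_mod_cast this
    refine ⟨W, hW, ?_, ?_⟩
    · intro w hw
      obtain ⟨a, b, c, e⟩ := hmem w hw
      simp only [Zsqrtd.norm_def]
      nlinarith
    · intro w hw w' hw' ⟨u, hu⟩
      obtain ⟨a, b, c, e⟩ := hmem w hw
      obtain ⟨a', b', c', e'⟩ := hmem w' hw'
      by_contra hne
      have hu0 : u ≠ 0 := by
        rintro rfl
        rw [mul_zero, sub_eq_zero] at hu
        exact hne hu
      have hN : (w - w').norm = p.norm * u.norm := by rw [hu, Zsqrtd.norm_mul]
      have hup : 0 < u.norm := GaussianInt.norm_pos.2 hu0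
      have hpp : 0 < p.norm := GaussianInt.norm_pos.2 hp.ne_zero
      have hge : p.norm ≤ (w - w').norm := by rw [hN]; nlinarith
      have hlt : (w - w').norm ≤ 2 * (m * m) := by
        simp only [Zsqrtd.norm_def, Zsqrtd.re_sub, Zsqrtd.im_sub]
        have := abs_le_of_sq_le_sq' (a := w.re - w'.re) (b := m)
        nlinarith [mul_nonneg (sub_nonneg.2 b) (sub_nonneg.2 b')]
      linarith
  · have hcard := gauss_card_quot p
    have hn := GaussianInt.norm_pos.2 hp.ne_zero
    have : Finite (GaussianInt ⧸ Ideal.span {p}) := by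
      apply Nat.finite_of_card_ne_zero
      rw [hcard]; omega
    have := Fintype.ofFinite (GaussianInt ⧸ Ideal.span {p})
    have hq : ∀ w : GaussianInt, (Ideal.Quotient.mk (Ideal.span {p}) (w % p)) = Ideal.Quotient.mk (Ideal.span {p}) w := by
      intro w
      rw [Ideal.Quotient.eq, Ideal.mem_span_singleton]
      have := EuclideanDomain.div_add_mod w p
      refine ⟨-(w / p), ?_⟩
      linear_combination this
    have hr : ∀ c : GaussianInt ⧸ Ideal.span {p}, Ideal.Quotient.mk (Ideal.span {p}) (Quotient.out c % p) = c := by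
      intro c
      rw [hq]; exact Quotient.out_eq c
    let B : Finset GaussianInt := Finset.univ.image (fun c : GaussianInt ⧸ Ideal.span {p} => Quotient.out c % p)
    have hB : d ≤ B.card := by
      rw [Finset.card_image_of_injective, Finset.card_univ, ← Nat.card_eq_fintype_card, hcard]
      · omega
      · intro c c' h
        rw [← hr c, ← hr c']; simp only at h; rw [h]
    obtain ⟨W, hWB, hW⟩ := Finset.exists_subset_card_eq hB
    refine ⟨W, hW, ?_, ?_⟩
    · intro w hw
      obtain ⟨c, -, rfl⟩ := Finset.mem_image.1 (hWB hw)
      have := GaussianInt.norm_mod_lt (Quotient.out c) hp.ne_zero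
      omega
    · intro w hw w' hw' hdvd
      obtain ⟨c, -, rfl⟩ := Finset.mem_image.1 (hWB hw)
      obtain ⟨c', -, rfl⟩ := Finset.mem_image.1 (hWB hw')
      rw [← Ideal.mem_span_singleton, ← Ideal.Quotient.eq, hr, hr] at hdvd
      rw [hdvd]

lemma exists_nodes (p : GaussianInt) (hp : Prime p) (n : ℕ) :
    ∃ (I : Type) (_ : Fintype I) (v : I → GaussianInt) (K : ℕ), n < Fintype.card I ∧
      (∀ i, (v i).norm ≤ 12 * (n + 1)) ∧ (∀ i j, p ^ (K + 1) ∣ v i - v j → i = j) ∧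
      ∀ k ≤ K, ∀ z z' : GaussianInt,
        Nat.card {i // p ^ k ∣ z - v i} = Nat.card {i // p ^ k ∣ z' - v i} := by
  classical
  have hn : 0 < p.norm := GaussianInt.norm_pos.2 hp.ne_zero
  obtain ⟨q, hq⟩ : ∃ q : ℕ, p.norm = q := Int.eq_ofNat_of_zero_le hn.le
  have hq1 : 1 < q := by
    have h1 : p.norm ≠ 1 := fun h => hp.not_isUnit ((Zsqrtd.norm_eq_one_iff' (by norm_num) p).1 h)
    omega
  set K := Nat.log q (n + 1) with hK
  have hK1 : q ^ K ≤ n + 1 := Nat.pow_log_le_self q (by omega)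
  have hK2 : n + 1 < q ^ (K + 1) := Nat.lt_pow_succ_log_self hq1 _
  have hqK : 0 < q ^ K := by positivity
  set d := (n + 1) / q ^ K + 1 with hd
  have hdq : d ≤ q := by
    have : (n + 1) / q ^ K < q := by
      rw [Nat.div_lt_iff_lt_mul hqK]
      rwa [pow_succ, mul_comm] at hK2
    omega
  have hd1 : n + 1 < q ^ K * d := by
    rw [hd]; exact Nat.lt_mul_div_succ _ hqK
  have hd2 : q ^ K * d ≤ 2 * (n + 1) := by
    rw [hd, mul_add]
    have := Nat.mul_div_le (n + 1) (q ^ K)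
    omega
  obtain ⟨W, hWc, hWn, hWd⟩ := exists_W p hp d (Nat.succ_pos _) (by rw [hq]; exact_mod_cast hdq)
  set P := p ^ K with hP
  have hP0 : P ≠ 0 := pow_ne_zero _ hp.ne_zero
  have hPn : P.norm = (q : ℤ) ^ K := by
    have := map_pow (Zsqrtd.normMonoidHom (d := -1)) p K
    rw [← hq]; exact this
  have hcard := gauss_card_quot P
  have hcard' : Nat.card (GaussianInt ⧸ Ideal.span {P}) = q ^ K := by
    rw [hcard, hPn]; norm_cast
  have : Finite (GaussianInt ⧸ Ideal.span {P}) := by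
    apply Nat.finite_of_card_ne_zero
    rw [hcard']; omega
  let _ := Fintype.ofFinite (GaussianInt ⧸ Ideal.span {P})
  have hr : ∀ c : GaussianInt ⧸ Ideal.span {P},
      Ideal.Quotient.mk (Ideal.span {P}) (Quotient.out c % P) = c := by
    intro c
    have : Ideal.Quotient.mk (Ideal.span {P}) (Quotient.out c % P)
        = Ideal.Quotient.mk (Ideal.span {P}) (Quotient.out c) := by
      rw [Ideal.Quotient.eq, Ideal.mem_span_singleton]
      have := EuclideanDomain.div_add_mod (Quotient.out c) P
      refine ⟨-(Quotient.out c / P), ?_⟩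
      linear_combination this
    rw [this]; exact Quotient.out_eq c
  have hrn : ∀ c : GaussianInt ⧸ Ideal.span {P}, (Quotient.out c % P).norm < P.norm :=
    fun c => GaussianInt.norm_mod_lt _ hP0
  generalize hrep : (fun c : GaussianInt ⧸ Ideal.span {P} => Quotient.out c % P) = r
  have hr' : ∀ c, Ideal.Quotient.mk (Ideal.span {P}) (r c) = c := by
    intro c; rw [← hrep]; exact hr c
  have hrn' : ∀ c, (r c).norm < P.norm := by
    intro c; rw [← hrep]; exact hrn c
  refine ⟨(GaussianInt ⧸ Ideal.span {P}) × W, inferInstance, fun x => r x.1 + P * x.2, K,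
    ?_, ?_, ?_, ?_⟩
  · rw [Fintype.card_prod, ← Nat.card_eq_fintype_card, hcard', Fintype.card_coe, hWc]
    omega
  · rintro ⟨c, w, hw⟩
    have h1 := gauss_norm_add_le (r c) (P * w)
    rw [Zsqrtd.norm_mul] at h1
    have h2 := hrn' c
    have h3 := hWn w hw
    rw [hPn] at h1 h2
    have h4 : (q : ℤ) ^ K * d ≤ 2 * (n + 1) := by exact_mod_cast hd2
    have h5 : (0 : ℤ) < (q : ℤ) ^ K := by positivity
    have h6 : (1 : ℤ) ≤ d := by exact_mod_cast Nat.succ_pos ((n + 1) / q ^ K)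
    have h7 := mul_le_mul_of_nonneg_left h3 h5.le
    have h8 := mul_le_mul_of_nonneg_left h6 h5.le
    simp only
    linarith
  · rintro ⟨c, w, hw⟩ ⟨c', w', hw'⟩ h
    simp only at h
    have hcc : c = c' := by
      rw [← hr' c, ← hr' c', Ideal.Quotient.eq, Ideal.mem_span_singleton]
      have h1 : P ∣ r c + P * w - (r c' + P * w') := (pow_dvd_pow p (Nat.le_succ K)).trans h
      have h2 : P ∣ P * (w - w') := dvd_mul_right _ _
      have := dvd_sub h1 h2
      convert this using 1; ring
    subst hcc
    have h3 : P * p ∣ P * (w - w') := by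
      rw [hP, ← pow_succ]; convert h using 1; ring
    have h4 := hWd w hw w' hw' ((mul_dvd_mul_iff_left hP0).1 h3)
    subst h4; rfl
  · intro k hk z z'
    have hkP : p ^ k ∣ P := pow_dvd_pow p hk
    have key : ∀ (c : GaussianInt ⧸ Ideal.span {P}) (w : GaussianInt) (u u' : GaussianInt),
        p ^ k ∣ u - (r c + P * w) →
        p ^ k ∣ u' - (r (c + Ideal.Quotient.mk _ (u' - u)) + P * w) := by
      intro c w u u' h
      have h1 : P ∣ r (c + Ideal.Quotient.mk _ (u' - u)) - (r c + (u' - u)) := by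
        rw [← Ideal.mem_span_singleton, ← Ideal.Quotient.eq, hr', map_add, hr']
      have := dvd_sub h (hkP.trans h1)
      convert this using 1; ring
    refine Nat.card_congr
      { toFun := fun x => ⟨(x.1.1 + Ideal.Quotient.mk _ (z' - z), x.1.2), key _ _ _ _ x.2⟩
        invFun := fun x => ⟨(x.1.1 + Ideal.Quotient.mk _ (z - z'), x.1.2), key _ _ _ _ x.2⟩
        left_inv := ?_
        right_inv := ?_ }
    · rintro ⟨⟨c, w⟩, h⟩
      simp [add_assoc, ← map_add]
    · rintro ⟨⟨c, w⟩, h⟩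
      simp [add_assoc, ← map_add]

lemma prod_local (p : GaussianInt) (hp : Prime p) {I : Type} [Fintype I] [DecidableEq I]
    (v : I → GaussianInt) (K : ℕ) (hv : ∀ i j, p ^ (K + 1) ∣ v i - v j → i = j)
    (hk : ∀ k ≤ K, ∀ z z' : GaussianInt,
        Nat.card {i // p ^ k ∣ z - v i} = Nat.card {i // p ^ k ∣ z' - v i})
    (i : I) (z : GaussianInt) :
    ∃ a b, ¬ p ∣ b ∧ b * ∏ j ∈ Finset.univ.erase i, (z - v j)
      = a * ∏ j ∈ Finset.univ.erase i, (v i - v j) := by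
  classical
  have h1 : ∀ j : I, ∃ b, j ∈ Finset.univ.erase i →
      v i - v j = p ^ vK p K (v i - v j) * b ∧ ¬ p ∣ b := by
    intro j
    obtain ⟨b, hb⟩ := vK_dvd p K (v i - v j)
    refine ⟨b, fun hj => ⟨hb, ?_⟩⟩
    rintro ⟨c, rfl⟩
    refine vK_not_dvd p K (v i - v j) (fun h => Finset.ne_of_mem_erase hj (hv i j h).symm)
      ⟨c, ?_⟩
    rw [pow_succ, mul_assoc]; exact hb
  choose b hb using h1
  have h2 : ∀ j : I, ∃ a, z - v j = p ^ vK p K (z - v j) * a := fun j => vK_dvd p K (z - v j)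
  choose a ha using h2
  have hsum : ∑ j ∈ Finset.univ.erase i, vK p K (v i - v j)
      ≤ ∑ j ∈ Finset.univ.erase i, vK p K (z - v j) := by
    simp only [vK, Finset.card_filter]
    rw [Finset.sum_comm, Finset.sum_comm (s := Finset.univ.erase i)]
    apply Finset.sum_le_sum
    intro k hkK
    have hc := hk k (Finset.mem_Icc.1 hkK).2 z (v i)
    rw [Nat.card_eq_fintype_card, Nat.card_eq_fintype_card, Fintype.card_subtype,
      Fintype.card_subtype, Finset.card_filter, Finset.card_filter,
      ← Finset.add_sum_erase _ _ (Finset.mem_univ i),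
      ← Finset.add_sum_erase _ _ (Finset.mem_univ i)] at hc
    simp only [sub_self, dvd_zero, if_true] at hc
    have : (if p ^ k ∣ z - v i then 1 else 0) ≤ 1 := by split_ifs <;> omega
    omega
  obtain ⟨e, he⟩ := Nat.exists_eq_add_of_le hsum
  refine ⟨p ^ e * ∏ j ∈ Finset.univ.erase i, a j, ∏ j ∈ Finset.univ.erase i, b j, ?_, ?_⟩
  · rw [hp.dvd_finsetProd_iff]
    rintro ⟨j, hj, hd⟩
    exact (hb j hj).2 hd
  · have e1 : ∏ j ∈ Finset.univ.erase i, (z - v j)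
        = p ^ (∑ j ∈ Finset.univ.erase i, vK p K (z - v j)) * ∏ j ∈ Finset.univ.erase i, a j := by
      rw [← Finset.prod_pow_eq_pow_sum, ← Finset.prod_mul_distrib]
      exact Finset.prod_congr rfl fun j _ => ha j
    have e2 : ∏ j ∈ Finset.univ.erase i, (v i - v j)
        = p ^ (∑ j ∈ Finset.univ.erase i, vK p K (v i - v j)) * ∏ j ∈ Finset.univ.erase i, b j := by
      rw [← Finset.prod_pow_eq_pow_sum, ← Finset.prod_mul_distrib]
      exact Finset.prod_congr rfl fun j hj => (hb j hj).1
    rw [e1, e2, he]; ring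

lemma mem_range_of_local (x : FF)
    (h : ∀ p : GaussianInt, Prime p → ∃ b, ¬ p ∣ b ∧ ι b * x ∈ Set.range ι) :
    x ∈ Set.range ι := by
  let J : Ideal GaussianInt :=
    { carrier := {b | ι b * x ∈ Set.range ι}
      zero_mem' := ⟨0, by simp⟩
      add_mem' := by
        rintro a b ⟨c, hc⟩ ⟨e, he⟩
        exact ⟨c + e, by rw [map_add, map_add, hc, he]; ring⟩
      smul_mem' := by
        rintro a b ⟨c, hc⟩
        exact ⟨a * c, by rw [smul_eq_mul, map_mul, map_mul, hc]; ring⟩ }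
  have hJ : J = ⊤ := by
    by_contra hne
    obtain ⟨m, hm, hJm⟩ := Ideal.exists_le_maximal J hne
    obtain ⟨g, hg⟩ := IsPrincipalIdealRing.principal m
    have hg' : m = Ideal.span {g} := hg
    have hJ0 : ∃ b ∈ J, b ≠ 0 := by
      obtain ⟨a, b, hb, hab⟩ := IsFractionRing.div_surjective (A := GaussianInt) x
      have hb0 : b ≠ 0 := nonZeroDivisors.ne_zero hb
      refine ⟨b, ⟨a, ?_⟩, hb0⟩
      have : (algebraMap GaussianInt FF) b ≠ 0 := by
        simpa using hb0
      rw [← hab]; simp only [ι]; field_simp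
    obtain ⟨b0, hb0, hb0'⟩ := hJ0
    have hg0 : g ≠ 0 := by
      rintro rfl
      have := hJm hb0
      rw [hg'] at this
      simp at this
      exact hb0' this
    have hpr : Prime g := by
      rw [← Ideal.span_singleton_prime hg0, ← hg']; exact hm.isPrime
    obtain ⟨b, hb, hbx⟩ := h g hpr
    have : b ∈ m := hJm hbx
    rw [hg', Ideal.mem_span_singleton] at this
    exact hb this
  have h1 : (1 : GaussianInt) ∈ J := by rw [hJ]; trivial
  have h2 : ι 1 * x ∈ Set.range ι := h1
  simpa using h2

lemma sum_local (p : GaussianInt) (hp : Prime p) {I : Type} (s : Finset I) (x : I → FF)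
    (h : ∀ i ∈ s, ∃ b, ¬ p ∣ b ∧ ι b * x i ∈ Set.range ι) :
    ∃ b, ¬ p ∣ b ∧ ι b * ∑ i ∈ s, x i ∈ Set.range ι := by
  classical
  induction s using Finset.induction_on with
  | empty => exact ⟨1, hp.not_dvd_one, 0, by simp⟩
  | insert a s ha ih =>
    obtain ⟨b, hb, c, hc⟩ := ih fun i hi => h i (Finset.mem_insert_of_mem hi)
    obtain ⟨b', hb', c', hc'⟩ := h a (Finset.mem_insert_self _ _)
    refine ⟨b * b', fun hd => (hp.dvd_or_dvd hd).elim hb hb', b * c' + b' * c, ?_⟩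
    rw [Finset.sum_insert ha, map_add, map_mul, map_mul, map_mul, hc, hc']
    ring

/-- There is an absolute constant `K` such that for every `n` there exists an
`n`-universal set in `ℤ[i]` of cardinality at most `K * (n + 1)`. -/
theorem exists_linear_size_universal_set :
    ∃ K : ℕ, ∀ n : ℕ, ∃ M : Finset GaussianInt,
      M.card ≤ K * (n + 1) ∧ IsNUniversal n (M : Set GaussianInt) := by
  classical
  refine ⟨9 * 12, fun n => ?_⟩
  set B := Nat.sqrt (12 * (n + 1)) with hB
  have hB1 : B * B ≤ 12 * (n + 1) := Nat.sqrt_le _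
  have hB2 : 12 * (n + 1) < (B + 1) * (B + 1) := Nat.lt_succ_sqrt _
  have hB0 : 1 ≤ B := by
    by_contra hc
    have : B = 0 := by omega
    rw [this] at hB2; omega
  refine ⟨(Finset.Icc (-(B : ℤ)) B ×ˢ Finset.Icc (-(B : ℤ)) B).image
      (fun x => (⟨x.1, x.2⟩ : GaussianInt)), ?_, ?_⟩
  · refine Finset.card_image_le.trans ?_
    rw [Finset.card_product, Int.card_Icc]
    have : ((B : ℤ) + 1 - -(B : ℤ)).toNat = 2 * B + 1 := by omega
    rw [this]
    nlinarith
  · intro f hf hM z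
    apply mem_range_of_local
    intro p hp
    obtain ⟨I, _, v, K, hI, hvn, hv, hk⟩ := exists_nodes p hp n
    have hιinj : Function.Injective ι := IsFractionRing.injective GaussianInt FF
    have hinj : Function.Injective v := fun i j h => hv i j (by rw [h, sub_self]; exact dvd_zero _)
    have hmem : ∀ i, f.eval (ι (v i)) ∈ Set.range ι := by
      intro i
      apply hM
      have h1 := hvn i
      rw [Zsqrtd.norm_def] at h1
      have h2 : (12 * (n + 1) : ℤ) < (B + 1) * (B + 1) := by exact_mod_cast hB2
      simp only [Finset.coe_image, Set.mem_image, Finset.mem_coe, Finset.mem_product,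
        Finset.mem_Icc]
      refine ⟨((v i).re, (v i).im), ⟨⟨?_, ?_⟩, ⟨?_, ?_⟩⟩, rfl⟩ <;> simp only <;>
        nlinarith [mul_self_nonneg (v i).re, mul_self_nonneg (v i).im]
    have hdeg : f.degree < (Finset.univ : Finset I).card := by
      rw [Finset.card_univ]
      refine lt_of_le_of_lt (Polynomial.degree_le_of_natDegree_le hf) ?_
      exact_mod_cast hI
    have hL := Lagrange.eq_interpolate (s := Finset.univ) (v := fun i => ι (v i))
      (fun i _ j _ h => hinj (hιinj h)) hdeg
    rw [hL, Lagrange.interpolate_apply, Polynomial.eval_finsetSum]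
    apply sum_local p hp
    intro i _
    obtain ⟨a, b, hb, hab⟩ := prod_local p hp v K hv hk i z
    obtain ⟨c, hc⟩ := hmem i
    refine ⟨b, hb, a * c, ?_⟩
    have hne : ∏ j ∈ Finset.univ.erase i, (ι (v i) - ι (v j)) ≠ 0 := by
      rw [Finset.prod_ne_zero_iff]
      intro j hj h
      exact Finset.ne_of_mem_erase hj (hinj (hιinj (sub_eq_zero.1 h))).symm
    have hev : (Lagrange.basis Finset.univ (fun i => ι (v i)) i).eval (ι z)
        = (∏ j ∈ Finset.univ.erase i, (ι (v i) - ι (v j)))⁻¹ *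
          ∏ j ∈ Finset.univ.erase i, (ι z - ι (v j)) := by
      rw [Lagrange.basis, Polynomial.eval_prod, ← Finset.prod_inv_distrib,
        ← Finset.prod_mul_distrib]
      refine Finset.prod_congr rfl fun j _ => ?_
      simp [Lagrange.basisDivisor]
    have hab' := congrArg ι hab
    simp only [map_mul, map_prod, map_sub] at hab'
    rw [Polynomial.eval_mul, Polynomial.eval_C, hev, ← hc, map_mul]
    field_simp
    linear_combination (-ι c) * hab'
end
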